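/- arXiv:2506.17260 — 12 statements merged into one kernel-verified Lean document; each statement's English description precedes it below -/
import Mathlib

section
/- Let m, n ≥ 2 and let a : Fin m → Fin n → Fin m → Fin n → ℝ be real coefficients. Define the m×n biquadratic polynomial f : ℝ^m × ℝ^n → ℝ by f(x̂,ŷ) = Σ_{i,k=1}^m Σ_{j,l=1}^n a_{ijkl} x̂_i ŷ_j x̂_k ŷ_l, and define h : ℝ^{m-1} × ℝ^{n-1} × ℝ → ℝ by h(x,y,z) = f((x_1,…,x_{m-1},z),(y_1,…,y_{n-1},z)), i.e., h is obtained from f by substituting the last x-variable and the last y-variable both by z. Then f(x̂,ŷ) ≥ 0 for all x̂ ∈ ℝ^m, ŷ ∈ ℝ^n if and only if h(x,y,z) ≥ 0 for all x ∈ ℝ^{m-1}, y ∈ ℝ^{n-1}, z ∈ ℝ. -/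
/-- A real function that is continuous and nonnegative off two points is nonnegative. -/
theorem Continuous.nonneg_of_forall_ne_ne {g : ℝ → ℝ} (hg : Continuous g) (p q : ℝ)
    (h : ∀ t, t ≠ p → t ≠ q → 0 ≤ g t) (t : ℝ) : 0 ≤ g t := by
  have hd : Dense ({p, q}ᶜ : Set ℝ) :=
    ((Set.toFinite {p, q}).countable).dense_compl ℝ
  have hs : ({p, q}ᶜ : Set ℝ) ⊆ {t | 0 ≤ g t} := by
    intro t ht
    simp only [Set.mem_compl_iff, Set.mem_insert_iff, Set.mem_singleton_iff, not_or] at ht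
    exact h t ht.1 ht.2
  exact closure_minimal hs (isClosed_le continuous_const hg) (hd t)


/-- An (m+1)×(n+1) biquadratic polynomial `f` (with m+1, n+1 ≥ 2) is PSD
iff the tripartite polynomial `h`, obtained by substituting the last x-variable and the
last y-variable both by `z`, is PSD. -/
theorem biquadratic_psd_iff_tripartite_psd (m n : ℕ) (hm : 1 ≤ m) (hn : 1 ≤ n)
    (a : Fin (m + 1) → Fin (n + 1) → Fin (m + 1) → Fin (n + 1) → ℝ)
    (f : (Fin (m + 1) → ℝ) → (Fin (n + 1) → ℝ) → ℝ)
    (hf : ∀ x y, f x y = ∑ i, ∑ k, ∑ j, ∑ l, a i j k l * x i * y j * x k * y l)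
    (h : (Fin m → ℝ) → (Fin n → ℝ) → ℝ → ℝ)
    (hh : ∀ x y z, h x y z = f (Fin.snoc x z) (Fin.snoc y z)) :
    (∀ x y, 0 ≤ f x y) ↔ (∀ x y z, 0 ≤ h x y z) := by
  refine ⟨fun H x y z => hh x y z ▸ H _ _, fun H x y => ?_⟩
  have hscale : ∀ (s t : ℝ) x y, f (s • x) (t • y) = (s * t) ^ 2 * f x y := by
    intro s t x y
    simp only [hf, Finset.mul_sum, Pi.smul_apply, smul_eq_mul]
    refine Finset.sum_congr rfl fun i _ => Finset.sum_congr rfl fun k _ =>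
      Finset.sum_congr rfl fun j _ => Finset.sum_congr rfl fun l _ => ?_
    ring
  have hdiag : ∀ x y, x (Fin.last m) = y (Fin.last n) → 0 ≤ f x y := by
    intro x y hxy
    have hnonneg := H (Fin.init x) (Fin.init y) (x (Fin.last m))
    rw [hh, Fin.snoc_init_self, hxy, Fin.snoc_init_self] at hnonneg
    exact hnonneg
  have hgen : ∀ x y, x (Fin.last m) ≠ 0 → y (Fin.last n) ≠ 0 → 0 ≤ f x y := by
    intro x y hx hy
    have hnonneg := hdiag (y (Fin.last n) • x) (x (Fin.last m) • y) (mul_comm _ _)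
    rw [hscale] at hnonneg
    exact nonneg_of_mul_nonneg_right hnonneg (by positivity)
  have hcont : Continuous fun t : ℝ => f (fun i => x i + t) (fun j => y j + t) := by
    simp only [hf]
    fun_prop
  have hnonneg := hcont.nonneg_of_forall_ne_ne (-x (Fin.last m)) (-y (Fin.last n))
    (fun t hx hy => hgen _ _ (fun h0 => hx (by linarith)) (fun h0 => hy (by linarith))) 0
  simpa using hnonneg
end

section
/- Let m, n ≥ 2 and let a : Fin m → Fin n → Fin m → Fin n → ℝ be real coefficients. Define f : ℝ^m × ℝ^n → ℝ by f(x̂,ŷ) = Σ_{i,k=1}^m Σ_{j,l=1}^n a_{ijkl} x̂_i ŷ_j x̂_k ŷ_l, and define h : ℝ^{m-1} × ℝ^{n-1} × ℝ → ℝ by h(x,y,z) = f((x_1,…,x_{m-1},z),(y_1,…,y_{n-1},z)). Then f is a sum of squares of quadratic forms on ℝ^{m+n} (i.e., there exist finitely many real symmetric (m+n)×(m+n) matrices A_t such that f(x̂,ŷ) = Σ_t (vᵀ A_t v)² for all x̂,ŷ, where v = (x̂,ŷ) ∈ ℝ^{m+n}) if and only if h is a sum of squares of quadratic forms on ℝ^{m+n-1}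 (i.e., there exist finitely many real symmetric (m+n-1)×(m+n-1) matrices B_t such that h(x,y,z) = Σ_t (wᵀ B_t w)² for all x,y,z, where w = (x,y,z) ∈ ℝ^{m+n-1}). -/
open Matrix

/-- The quadratic form of a bilinear form is given by a symmetric matrix. -/
lemma exists_isSymm_dotProduct_mulVec_eq {ι : Type*} [Fintype ι] [DecidableEq ι]
    (b : (ι → ℝ) →ₗ[ℝ] (ι → ℝ) →ₗ[ℝ] ℝ) :
    ∃ A : Matrix ι ι ℝ, A.IsSymm ∧ ∀ v, v ⬝ᵥ A.mulVec v = b v v := by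
  set N := LinearMap.toMatrix₂' ℝ b with hN
  have hb : ∀ v, b v v = v ⬝ᵥ N.mulVec v := fun v ↦ by
    rw [← Matrix.toLinearMap₂'_apply', hN, Matrix.toLinearMap₂'_toMatrix']
  refine ⟨(1 / 2 : ℝ) • (N + Nᵀ), (isSymm_add_transpose_self N).smul _, fun v ↦ ?_⟩
  have ht : v ⬝ᵥ Nᵀ.mulVec v = v ⬝ᵥ N.mulVec v := by
    rw [mulVec_transpose, dotProduct_comm, dotProduct_mulVec]
  rw [hb, smul_mulVec, add_mulVec, dotProduct_smul, dotProduct_add, ht, smul_eq_mul]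
  ring

/-- A bilinear map in `(x, y)` is a quadratic form in the concatenated vector. -/
lemma exists_isSymm_append_dotProduct_eq {p q : ℕ}
    (P : (Fin p → ℝ) →ₗ[ℝ] (Fin q → ℝ) →ₗ[ℝ] ℝ) :
    ∃ A : Matrix (Fin (p + q)) (Fin (p + q)) ℝ, A.IsSymm ∧
      ∀ x y, Fin.append x y ⬝ᵥ A.mulVec (Fin.append x y) = P x y := by
  obtain ⟨A, hA, hAP⟩ := exists_isSymm_dotProduct_mulVec_eq
    (P.compl₁₂ (LinearMap.funLeft ℝ ℝ (Fin.castAdd q)) (LinearMap.funLeft ℝ ℝ (Fin.natAdd p)))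
  refine ⟨A, hA, fun x y ↦ ?_⟩
  rw [hAP, LinearMap.compl₁₂_apply]
  congr 2 <;> ext i <;> simp [LinearMap.funLeft_apply]

/-- The linear embedding `(x, s) ↦ (x, 0, s)`. -/
def leftEmbedding (m n : ℕ) : (Fin (m + 1) → ℝ) →ₗ[ℝ] (Fin (m + n + 1) → ℝ) :=
  LinearMap.pi (Fin.snoc (α := fun _ ↦ (Fin (m + 1) → ℝ) →ₗ[ℝ] ℝ)
    (Fin.append (fun i : Fin m ↦ LinearMap.proj i.castSucc) (fun _ : Fin n ↦ 0))
    (LinearMap.proj (Fin.last m)))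

/-- The linear embedding `(y, t) ↦ (0, y, t)`. -/
def rightEmbedding (m n : ℕ) : (Fin (n + 1) → ℝ) →ₗ[ℝ] (Fin (m + n + 1) → ℝ) :=
  LinearMap.pi (Fin.snoc (α := fun _ ↦ (Fin (n + 1) → ℝ) →ₗ[ℝ] ℝ)
    (Fin.append (fun _ : Fin m ↦ 0) (fun j : Fin n ↦ LinearMap.proj j.castSucc))
    (LinearMap.proj (Fin.last n)))

lemma leftEmbedding_snoc {m n : ℕ} (x : Fin m → ℝ) (s : ℝ) :
    leftEmbedding m n (Fin.snoc x s) =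
      Fin.snoc (α := fun _ ↦ ℝ) (Fin.append x (0 : Fin n → ℝ)) s := by
  ext i
  refine Fin.lastCases ?_ (fun i ↦ Fin.addCases (fun i ↦ ?_) (fun i ↦ ?_) i) i <;>
    simp [-Fin.castSucc_natAdd, leftEmbedding]

lemma rightEmbedding_snoc {m n : ℕ} (y : Fin n → ℝ) (t : ℝ) :
    rightEmbedding m n (Fin.snoc y t) =
      Fin.snoc (α := fun _ ↦ ℝ) (Fin.append (0 : Fin m → ℝ) y) t := by
  ext i
  refine Fin.lastCases ?_ (fun i ↦ Fin.addCases (fun i ↦ ?_) (fun i ↦ ?_) i) i <;>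
    simp [-Fin.castSucc_natAdd, rightEmbedding]

/-- A quadratic form in `(x, y, z)` without `x x` and `y y` terms is, on `z = 1`, the
dehomogenization of a bilinear map. -/
lemma exists_bilinear_snoc_one_eq {m n : ℕ} (B : Matrix (Fin (m + n + 1)) (Fin (m + n + 1)) ℝ)
    (hB : B.IsSymm)
    (hx : ∀ x : Fin m → ℝ, Fin.snoc (α := fun _ ↦ ℝ) (Fin.append x (0 : Fin n → ℝ)) 0 ⬝ᵥ
      B.mulVec (Fin.snoc (α := fun _ ↦ ℝ) (Fin.append x (0 : Fin n → ℝ)) 0) = 0)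
    (hy : ∀ y : Fin n → ℝ, Fin.snoc (α := fun _ ↦ ℝ) (Fin.append (0 : Fin m → ℝ) y) 0 ⬝ᵥ
      B.mulVec (Fin.snoc (α := fun _ ↦ ℝ) (Fin.append (0 : Fin m → ℝ) y) 0) = 0) :
    ∃ P : (Fin (m + 1) → ℝ) →ₗ[ℝ] (Fin (n + 1) → ℝ) →ₗ[ℝ] ℝ, ∀ x y,
      P (Fin.snoc x 1) (Fin.snoc y 1) =
        Fin.snoc (α := fun _ ↦ ℝ) (Fin.append x y) 1 ⬝ᵥ
          B.mulVec (Fin.snoc (α := fun _ ↦ ℝ) (Fin.append x y) 1) := by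
  set b : (Fin (m + n + 1) → ℝ) →ₗ[ℝ] (Fin (m + n + 1) → ℝ) →ₗ[ℝ] ℝ :=
    Matrix.toLinearMap₂' ℝ B
  set e : Fin (m + n + 1) → ℝ := Fin.snoc (α := fun _ ↦ ℝ) (Fin.append 0 0) 1
  have hsymm : ∀ u v, u ⬝ᵥ B.mulVec v = v ⬝ᵥ B.mulVec u := fun u v ↦ by
    rw [dotProduct_mulVec, ← mulVec_transpose, hB.eq, dotProduct_comm]
  refine ⟨(2 : ℝ) • b.compl₁₂ (leftEmbedding m n) (rightEmbedding m n) -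
    b e e • (LinearMap.mul ℝ ℝ).compl₁₂ (LinearMap.proj (Fin.last m))
      (LinearMap.proj (Fin.last n)), fun x y ↦ ?_⟩
  set u : Fin (m + n + 1) → ℝ := Fin.snoc (α := fun _ ↦ ℝ) (Fin.append x (0 : Fin n → ℝ)) 0
  set v : Fin (m + n + 1) → ℝ := Fin.snoc (α := fun _ ↦ ℝ) (Fin.append (0 : Fin m → ℝ) y) 0
  have hue : Fin.snoc (α := fun _ ↦ ℝ) (Fin.append x (0 : Fin n → ℝ)) 1 = u + e := by
    ext i
    refine Fin.lastCases ?_ (fun i ↦ Fin.addCases (fun i ↦ ?_) (fun i ↦ ?_) i) i <;>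
      simp [-Fin.castSucc_natAdd, u, e]
  have hve : Fin.snoc (α := fun _ ↦ ℝ) (Fin.append (0 : Fin m → ℝ) y) 1 = v + e := by
    ext i
    refine Fin.lastCases ?_ (fun i ↦ Fin.addCases (fun i ↦ ?_) (fun i ↦ ?_) i) i <;>
      simp [-Fin.castSucc_natAdd, v, e]
  have huve : Fin.snoc (α := fun _ ↦ ℝ) (Fin.append x y) 1 = u + v + e := by
    ext i
    refine Fin.lastCases ?_ (fun i ↦ Fin.addCases (fun i ↦ ?_) (fun i ↦ ?_) i) i <;>
      simp [-Fin.castSucc_natAdd, u, v, e]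
  have hux : u ⬝ᵥ B.mulVec u = 0 := hx x
  have hvy : v ⬝ᵥ B.mulVec v = 0 := hy y
  simp only [LinearMap.sub_apply, LinearMap.smul_apply, LinearMap.compl₁₂_apply,
    leftEmbedding_snoc, rightEmbedding_snoc, hue, hve, huve, b, Matrix.toLinearMap₂'_apply',
    LinearMap.proj_apply, Fin.snoc_last, LinearMap.mul_apply', smul_eq_mul, mulVec_add,
    dotProduct_add, add_dotProduct, hux, hvy]
  rw [hsymm v u, hsymm e u, hsymm e v]
  ring

/-- Two separately continuous functions, homogeneous of degree two in each argument, agree if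
they agree where both last coordinates are `1`. -/
lemma eq_of_eq_snoc_one {m n : ℕ} {F G : (Fin (m + 1) → ℝ) → (Fin (n + 1) → ℝ) → ℝ}
    (hF : ∀ (c d : ℝ) x y, F (c • x) (d • y) = c ^ 2 * d ^ 2 * F x y)
    (hG : ∀ (c d : ℝ) x y, G (c • x) (d • y) = c ^ 2 * d ^ 2 * G x y)
    (hFx : ∀ y, Continuous fun x ↦ F x y) (hFy : ∀ x, Continuous (F x))
    (hGx : ∀ y, Continuous fun x ↦ G x y) (hGy : ∀ x, Continuous (G x))
    (hFG : ∀ x y, F (Fin.snoc x 1) (Fin.snoc y 1) = G (Fin.snoc x 1) (Fin.snoc y 1))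
    (x : Fin (m + 1) → ℝ) (y : Fin (n + 1) → ℝ) : F x y = G x y := by
  have hsnoc {k : ℕ} (w : Fin k → ℝ) :
      Continuous fun s : ℝ ↦ (Fin.snoc w s : Fin (k + 1) → ℝ) := by
    refine continuous_pi fun i ↦ Fin.lastCases ?_ (fun i ↦ ?_) i
    · simpa using continuous_id'
    · simpa using continuous_const
  have hsmul {k : ℕ} (w : Fin k → ℝ) {s : ℝ} (hs : s ≠ 0) :
      (Fin.snoc w s : Fin (k + 1) → ℝ) = s • Fin.snoc (α := fun _ ↦ ℝ) (s⁻¹ • w) 1 := by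
    ext i
    refine Fin.lastCases ?_ (fun i ↦ ?_) i <;> simp [hs]
  rw [← Fin.snoc_init_self x, ← Fin.snoc_init_self y]
  generalize x (Fin.last m) = s, y (Fin.last n) = t, Fin.init x = x', Fin.init y = y'
  have hst : ∀ s ≠ (0 : ℝ), ∀ t ≠ (0 : ℝ),
      F (Fin.snoc x' s) (Fin.snoc y' t) = G (Fin.snoc x' s) (Fin.snoc y' t) := by
    intro s hs t ht
    rw [hsmul x' hs, hsmul y' ht, hF, hG, hFG]
  have hs : ∀ s ≠ (0 : ℝ), ∀ t : ℝ,
      F (Fin.snoc x' s) (Fin.snoc y' t) = G (Fin.snoc x' s) (Fin.snoc y' t) := fun s hs ↦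
    congrFun (Continuous.ext_on (dense_compl_singleton (0 : ℝ)) ((hFy _).comp (hsnoc y'))
      ((hGy _).comp (hsnoc y')) fun t ht ↦ hst s hs t ht)
  exact congrFun (Continuous.ext_on (dense_compl_singleton (0 : ℝ)) ((hFx _).comp (hsnoc x'))
      ((hGx _).comp (hsnoc x')) fun r hr ↦ hs r hr t) s

/-- An (m+1)×(n+1) biquadratic polynomial `f` is a sum of squares of quadratic
forms on ℝ^(m+n+2) iff the tripartite polynomial `h`, obtained by substituting the last
x-variable and the last y-variable both by `z`, is a sum of squares of quadratic forms on
ℝ^(m+n+1). -/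
theorem biquadratic_sos_iff_tripartite_sos (m n : ℕ) (hm : 1 ≤ m) (hn : 1 ≤ n)
    (a : Fin (m + 1) → Fin (n + 1) → Fin (m + 1) → Fin (n + 1) → ℝ)
    (f : (Fin (m + 1) → ℝ) → (Fin (n + 1) → ℝ) → ℝ)
    (hf : ∀ x y, f x y = ∑ i, ∑ k, ∑ j, ∑ l, a i j k l * x i * y j * x k * y l)
    (h : (Fin m → ℝ) → (Fin n → ℝ) → ℝ → ℝ)
    (hh : ∀ x y z, h x y z = f (Fin.snoc x z) (Fin.snoc y z)) :
    (∃ (T : ℕ) (A : Fin T → Matrix (Fin (m + 1 + (n + 1))) (Fin (m + 1 + (n + 1))) ℝ),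
        (∀ t, (A t).IsSymm) ∧
        ∀ x y, f x y = ∑ t, (Fin.append x y ⬝ᵥ (A t).mulVec (Fin.append x y)) ^ 2) ↔
    (∃ (T : ℕ) (B : Fin T → Matrix (Fin (m + n + 1)) (Fin (m + n + 1)) ℝ),
        (∀ t, (B t).IsSymm) ∧
        ∀ x y z, h x y z =
          ∑ t, (Fin.snoc (Fin.append x y) z ⬝ᵥ
            (B t).mulVec (Fin.snoc (Fin.append x y) z)) ^ 2) := by
  constructor
  · rintro ⟨T, A, -, hfA⟩
    let L : (Fin (m + n + 1) → ℝ) →ₗ[ℝ] (Fin (m + 1 + (n + 1)) → ℝ) :=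
      LinearMap.funLeft ℝ ℝ (Fin.append
        (Fin.snoc (α := fun _ ↦ Fin (m + n + 1)) (fun i ↦ (Fin.castAdd n i).castSucc)
          (Fin.last (m + n)))
        (Fin.snoc (α := fun _ ↦ Fin (m + n + 1)) (fun j ↦ (Fin.natAdd m j).castSucc)
          (Fin.last (m + n))))
    have hL : ∀ (x : Fin m → ℝ) (y : Fin n → ℝ) (z : ℝ),
        L (Fin.snoc (α := fun _ ↦ ℝ) (Fin.append x y) z) =
          Fin.append (Fin.snoc x z : Fin (m + 1) → ℝ) (Fin.snoc y z : Fin (n + 1) → ℝ) := by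
      intro x y z
      ext i
      refine Fin.addCases (fun i ↦ ?_) (fun i ↦ ?_) i <;>
        refine Fin.lastCases ?_ (fun i ↦ ?_) i <;> simp [-Fin.castSucc_natAdd, -Fin.natAdd_last, L, LinearMap.funLeft_apply]
    choose B hB hBA using fun t ↦ exists_isSymm_dotProduct_mulVec_eq
      ((Matrix.toLinearMap₂' ℝ (A t)).compl₁₂ L L)
    refine ⟨T, B, hB, fun x y z ↦ ?_⟩
    simp only [hh, hfA, hBA, LinearMap.compl₁₂_apply, hL, Matrix.toLinearMap₂'_apply']
  · rintro ⟨T, B, hB, hhB⟩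
    have hzero {m' : ℕ} : (Fin.snoc (0 : Fin m' → ℝ) 0 : Fin (m' + 1) → ℝ) = 0 := by
      ext i
      refine Fin.lastCases ?_ (fun i ↦ ?_) i <;> simp
    have hvanish : ∀ x y, h x y 0 = 0 → ∀ t, Fin.snoc (α := fun _ ↦ ℝ) (Fin.append x y) 0 ⬝ᵥ
        (B t).mulVec (Fin.snoc (α := fun _ ↦ ℝ) (Fin.append x y) 0) = 0 := by
      intro x y hxy t
      rw [hhB, Finset.sum_eq_zero_iff_of_nonneg fun _ _ ↦ sq_nonneg _] at hxy
      exact pow_eq_zero_iff two_ne_zero |>.1 (hxy t (Finset.mem_univ t))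
    choose P hP using fun t ↦ exists_bilinear_snoc_one_eq (B t) (hB t)
      (fun x ↦ hvanish x 0 (by simp [hh, hf, hzero]) t)
      (fun y ↦ hvanish 0 y (by simp [hh, hf, hzero]) t)
    choose A hA hAP using fun t ↦ exists_isSymm_append_dotProduct_eq (P t)
    refine ⟨T, A, hA, fun x y ↦ ?_⟩
    simp only [hAP]
    refine eq_of_eq_snoc_one (G := fun x y ↦ ∑ t, (P t x y) ^ 2) ?_ ?_ ?_ ?_ ?_ ?_ ?_ x y
    · intro c d x y
      simp only [hf, Finset.mul_sum, Pi.smul_apply, smul_eq_mul]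
      refine Finset.sum_congr rfl fun i _ ↦ Finset.sum_congr rfl fun k _ ↦
        Finset.sum_congr rfl fun j _ ↦ Finset.sum_congr rfl fun l _ ↦ ?_
      ring
    · intro c d x y
      simp only [map_smul, LinearMap.smul_apply, smul_eq_mul, Finset.mul_sum]
      exact Finset.sum_congr rfl fun t _ ↦ by ring
    · intro y
      simp only [hf]
      fun_prop
    · intro x
      simp only [funext (hf x)]
      fun_prop
    · intro y
      exact continuous_finsetSum _ fun t _ ↦
        (((P t).flip y).continuous_of_finiteDimensional).pow 2
    · intro x
      exact continuous_finsetSum _ fun t _ ↦ ((P t x).continuous_of_finiteDimensional).pow 2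
    · intro x y
      simp only [← hh, hhB, hP]
end

section
/- Let f : ℝ² × ℝ² → ℝ be a 2×2 biquadratic polynomial, f(x,y) = Σ_{i,k=1}^2 Σ_{j,l=1}^2 a_{ijkl} x_i y_j x_k y_l with real coefficients a_{ijkl}. If f(x,y) ≥ 0 for all x, y ∈ ℝ², then there exist three real symmetric 4×4 matrices A₁, A₂, A₃ such that f(x,y) = Σ_{t=1}^3 (vᵀ A_t v)² for all x, y ∈ ℝ², where v = (x₁,x₂,y₁,y₂) ∈ ℝ⁴. In other words, every PSD 2×2 biquadratic polynomial is a sum of squares of three quadratic forms. -/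
open Matrix

/-- The homogeneous S-lemma for one equality constraint, with the least multiplier. -/
theorem QuadraticForm.exists_isLeast_multiplier {E : Type*} [AddCommGroup E] [Module ℝ E]
    (G D : QuadraticForm ℝ E) (hpos : ∃ z, 0 < D z) (hneg : ∃ w, D w < 0)
    (h : ∀ z, D z = 0 → 0 ≤ G z) :
    ∃ c : ℝ, IsLeast {c : ℝ | ∀ z, 0 ≤ G z + c * D z} c := by
  have cross : ∀ z w, 0 < D z → D w < 0 → -G z / D z ≤ -G w / D w := by
    intro z w hz hw
    set p := QuadraticMap.polar D z w with hp
    set g := QuadraticMap.polar G z w with hg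
    have expand : ∀ (Q : QuadraticForm ℝ E) (s : ℝ),
        Q (z + s • w) = Q z + s * QuadraticMap.polar Q z w + s ^ 2 * Q w := by
      intro Q s
      rw [QuadraticMap.map_add Q, QuadraticMap.map_smul, QuadraticMap.polar_smul_right]
      simp only [smul_eq_mul]
      ring
    set r := √(p ^ 2 - 4 * D z * D w) with hr
    have hdisc : p ^ 2 < p ^ 2 - 4 * D z * D w := by nlinarith [mul_pos hz (neg_pos.2 hw)]
    have hr2 : r ^ 2 = p ^ 2 - 4 * D z * D w := Real.sq_sqrt (by nlinarith [sq_nonneg p])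
    have habs : -r < p ∧ p < r :=
      abs_lt.1 (sq_lt_sq.1 (by rw [hr2]; exact hdisc) |>.trans_eq (abs_of_nonneg (Real.sqrt_nonneg _)))
    obtain ⟨h1, h2⟩ := habs
    have hD : D w ≠ 0 := hw.ne
    have root : ∀ e : ℝ, e ^ 2 = r ^ 2 →
        0 ≤ G z + (e - p) / (2 * D w) * g + ((e - p) / (2 * D w)) ^ 2 * G w := by
      intro e he
      rw [← expand G]
      apply h
      rw [expand D, ← hp]
      field_simp
      nlinarith
    have k1 := root r rfl
    have k2 := root (-r) (by ring)
    set s := (r - p) / (2 * D w) with hs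
    set t := (-r - p) / (2 * D w) with ht
    have hs0 : s < 0 := div_neg_of_pos_of_neg (by linarith) (by linarith)
    have ht0 : 0 < t := div_pos_of_neg_of_neg (by linarith) (by linarith)
    have hst : s * t = D z / D w := by
      rw [hs, ht]; field_simp; nlinarith
    have key : 0 ≤ (t - s) * (G z - s * t * G w) := by
      nlinarith [mul_nonneg ht0.le k1, mul_nonneg (neg_pos.2 hs0).le k2]
    have key2 : 0 ≤ G z - s * t * G w := nonneg_of_mul_nonneg_right key (by linarith)
    rw [hst] at key2
    have e : G z - D z / D w * G w = D z * (-G w / D w - -G z / D z) := by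
      field_simp; ring
    rw [e] at key2
    linarith [nonneg_of_mul_nonneg_right key2 hz]
  obtain ⟨z₀, hz₀⟩ := hpos
  obtain ⟨w₀, hw₀⟩ := hneg
  set S : Set ℝ := {c | ∃ z, 0 < D z ∧ -G z / D z = c} with hS
  have hlub : IsLUB S (sSup S) :=
    isLUB_csSup ⟨_, z₀, hz₀, rfl⟩ ⟨-G w₀ / D w₀, by rintro _ ⟨z, hz, rfl⟩; exact cross z w₀ hz hw₀⟩
  refine ⟨sSup S, fun z => ?_, fun c hc => hlub.2 ?_⟩
  · rcases lt_trichotomy (D z) 0 with hz | hz | hz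
    · have : sSup S ≤ -G z / D z := hlub.2 (by rintro _ ⟨y, hy, rfl⟩; exact cross y z hy hz)
      rw [le_div_iff_of_neg hz] at this
      linarith
    · simpa [hz] using h z hz
    · have : -G z / D z ≤ sSup S := hlub.1 ⟨z, hz, rfl⟩
      rw [div_le_iff₀ hz] at this
      linarith
  · rintro _ ⟨z, hz, rfl⟩
    rw [div_le_iff₀ hz]
    linarith [hc z]

/-- Orthogonal diagonalization of a real symmetric matrix, in terms of its quadratic form. -/
theorem Matrix.IsHermitian.exists_dotProduct_mulVec_eq_sum_sq {n : Type*} [Fintype n]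
    [DecidableEq n] {M : Matrix n n ℝ} (hM : M.IsHermitian) :
    ∃ (μ : n → ℝ) (U : Matrix n n ℝ), U * Uᵀ = 1 ∧ Uᵀ * U = 1 ∧
      ∀ z, z ⬝ᵥ M *ᵥ z = ∑ i, μ i * (U *ᵥ z) i ^ 2 := by
  have hU := hM.eigenvectorUnitary.2
  rw [Matrix.mem_unitaryGroup_iff] at hU
  have hU' := hM.eigenvectorUnitary.2
  rw [Matrix.mem_unitaryGroup_iff'] at hU'
  refine ⟨hM.eigenvalues, (hM.eigenvectorUnitary.1)ᵀ, ?_, ?_, fun z => ?_⟩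
  · simpa [Matrix.star_eq_conjTranspose] using hU'
  · simpa [Matrix.star_eq_conjTranspose] using hU
  · set V : Matrix n n ℝ := hM.eigenvectorUnitary.1
    have hspec : M = V * diagonal hM.eigenvalues * Vᵀ := by
      conv_lhs => rw [hM.spectral_theorem, Unitary.conjStarAlgAut_apply]
      rfl
    have hz : z ⬝ᵥ M *ᵥ z = (Vᵀ *ᵥ z) ⬝ᵥ diagonal hM.eigenvalues *ᵥ (Vᵀ *ᵥ z) := by
      conv_lhs => rw [hspec]
      rw [← mulVec_mulVec, ← mulVec_mulVec, dotProduct_mulVec, ← mulVec_transpose]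
    rw [hz]
    simp only [dotProduct, mulVec_diagonal]
    exact Finset.sum_congr rfl fun i _ => by ring

/-- A nonnegative quadratic form that becomes negative somewhere after subtracting any positive
multiple of `D` is a sum of one square fewer than the dimension. -/
theorem Matrix.IsHermitian.exists_sum_sq_of_isLeast {m : ℕ}
    {A B : Matrix (Fin (m + 1)) (Fin (m + 1)) ℝ} (hA : A.IsHermitian) (hB : B.IsHermitian)
    {C : ℝ} (hC : ∀ z, z ⬝ᵥ B *ᵥ z ≤ C * (z ⬝ᵥ z)) {c : ℝ}
    (hc : IsLeast {c : ℝ | ∀ z, 0 ≤ z ⬝ᵥ A *ᵥ z + c * (z ⬝ᵥ B *ᵥ z)} c) :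
    ∃ L : Fin m → Fin (m + 1) → ℝ,
      ∀ z, z ⬝ᵥ A *ᵥ z + c * (z ⬝ᵥ B *ᵥ z) = ∑ t, (L t ⬝ᵥ z) ^ 2 := by
  obtain ⟨μ, U, hU, hU', hq⟩ :=
    (hA.add (hB.smul (k := c) (IsSelfAdjoint.all c))).exists_dotProduct_mulVec_eq_sum_sq
  have hq' : ∀ z, z ⬝ᵥ A *ᵥ z + c * (z ⬝ᵥ B *ᵥ z) = ∑ i, μ i * (U *ᵥ z) i ^ 2 := by
    intro z
    rw [← hq, add_mulVec, smul_mulVec, dotProduct_add, dotProduct_smul, smul_eq_mul]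
  have hnorm : ∀ z, z ⬝ᵥ z = ∑ i, (U *ᵥ z) i ^ 2 := by
    intro z
    have : z ⬝ᵥ z = (U *ᵥ z) ⬝ᵥ (U *ᵥ z) := by
      rw [dotProduct_mulVec, ← mulVec_transpose, mulVec_mulVec, hU', one_mulVec]
    rw [this]
    simp only [dotProduct, sq]
  have hμ : ∀ i, 0 ≤ μ i := by
    intro i
    have h := hc.1 (Uᵀ *ᵥ Pi.single i 1)
    rw [hq', mulVec_mulVec, hU, one_mulVec, Finset.sum_eq_single i] at h
    · simpa using h
    · intro j _ hj
      simp [hj]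
    · simp
  obtain ⟨i₀, hi₀⟩ : ∃ i, μ i = 0 := by
    by_contra! hne
    have hpos : ∀ i, 0 < μ i := fun i => (hμ i).lt_of_ne (hne i).symm
    obtain ⟨i₁, hi₁⟩ := Finite.exists_min μ
    set ε := μ i₁ / (|C| + 1) with hε
    have hε0 : 0 < ε := div_pos (hpos i₁) (by positivity)
    have hεC : ε * C ≤ μ i₁ := by
      rw [hε, div_mul_eq_mul_div, div_le_iff₀ (by positivity)]
      nlinarith [le_abs_self C, hpos i₁]
    have hmem : c - ε ∈ {c : ℝ | ∀ z, 0 ≤ z ⬝ᵥ A *ᵥ z + c * (z ⬝ᵥ B *ᵥ z)} := by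
      intro z
      have h1 : μ i₁ * (z ⬝ᵥ z) ≤ z ⬝ᵥ A *ᵥ z + c * (z ⬝ᵥ B *ᵥ z) := by
        rw [hq', hnorm, Finset.mul_sum]
        exact Finset.sum_le_sum fun i _ => mul_le_mul_of_nonneg_right (hi₁ i) (sq_nonneg _)
      have h0 : 0 ≤ z ⬝ᵥ z := by
        rw [hnorm]
        positivity
      have h2 := mul_le_mul_of_nonneg_left (hC z) hε0.le
      have h3 := mul_le_mul_of_nonneg_right hεC h0
      linarith
    linarith [hc.2 hmem]
  refine ⟨fun t => √(μ (i₀.succAbove t)) • U (i₀.succAbove t), fun z => ?_⟩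
  rw [hq', Fin.sum_univ_succAbove _ i₀, hi₀, zero_mul, zero_add]
  refine Finset.sum_congr rfl fun t _ => ?_
  rw [smul_dotProduct, smul_eq_mul, mul_pow, Real.sq_sqrt (hμ _)]
  rfl

/-- The zeros of `z₀ z₃ - z₁ z₂` are the vectors `(x₀ y₀, x₀ y₁, x₁ y₀, x₁ y₁)`. -/
theorem exists_eq_outer_of_mul_eq_mul {K : Type*} [Field K] (z : Fin 4 → K)
    (h : z 0 * z 3 - z 1 * z 2 = 0) :
    ∃ x y : Fin 2 → K, z = ![x 0 * y 0, x 0 * y 1, x 1 * y 0, x 1 * y 1] := by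
  by_cases h0 : z 0 = 0
  · have h12 : z 1 = 0 ∨ z 2 = 0 := by simpa [h0] using h
    rcases h12 with h1 | h2
    · refine ⟨![0, 1], ![z 2, z 3], ?_⟩
      ext i; fin_cases i <;> simp [h0, h1]
    · refine ⟨![z 1, z 3], ![0, 1], ?_⟩
      ext i; fin_cases i <;> simp [h0, h2]
  · refine ⟨![1, z 2 / z 0], ![z 0, z 1], ?_⟩
    ext i; fin_cases i <;> simp [h0]
    field_simp
    linear_combination h

/-- Every PSD 2×2 biquadratic polynomial is a sum of squares of three
quadratic forms on ℝ⁴. -/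
theorem psd_2x2_biquadratic_is_sos_of_three_quadratics
    (a : Fin 2 → Fin 2 → Fin 2 → Fin 2 → ℝ)
    (f : (Fin 2 → ℝ) → (Fin 2 → ℝ) → ℝ)
    (hf : ∀ x y, f x y = ∑ i, ∑ k, ∑ j, ∑ l, a i j k l * x i * y j * x k * y l)
    (hpsd : ∀ x y, 0 ≤ f x y) :
    ∃ A : Fin 3 → Matrix (Fin (2 + 2)) (Fin (2 + 2)) ℝ,
      (∀ t, (A t).IsSymm) ∧
      ∀ x y : Fin 2 → ℝ,
        f x y = ∑ t, (Fin.append x y ⬝ᵥ (A t).mulVec (Fin.append x y)) ^ 2 := by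
  set G₀ : Matrix (Fin 4) (Fin 4) ℝ :=
    !![a 0 0 0 0, a 0 0 0 1, a 0 0 1 0, a 0 0 1 1;
       a 0 1 0 0, a 0 1 0 1, a 0 1 1 0, a 0 1 1 1;
       a 1 0 0 0, a 1 0 0 1, a 1 0 1 0, a 1 0 1 1;
       a 1 1 0 0, a 1 1 0 1, a 1 1 1 0, a 1 1 1 1] with hG₀
  set G : Matrix (Fin 4) (Fin 4) ℝ := (1 / 2 : ℝ) • (G₀ + G₀ᵀ) with hG
  set B : Matrix (Fin 4) (Fin 4) ℝ :=
    !![0, 0, 0, 1 / 2; 0, 0, -1 / 2, 0; 0, -1 / 2, 0, 0; 1 / 2, 0, 0, 0] with hB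
  have hGs : G.IsHermitian := by
    rw [Matrix.IsHermitian, conjTranspose_eq_transpose_of_trivial, hG, transpose_smul,
      transpose_add, transpose_transpose, add_comm]
  have hBs : B.IsHermitian := by
    rw [Matrix.IsHermitian, conjTranspose_eq_transpose_of_trivial]
    ext i j; fin_cases i <;> fin_cases j <;> rfl
  have hBz : ∀ z, z ⬝ᵥ B *ᵥ z = z 0 * z 3 - z 1 * z 2 := by
    intro z
    simp [hB, mulVec, dotProduct, Fin.sum_univ_four]
    ring
  have hGf : ∀ x y : Fin 2 → ℝ, f x y =
      ![x 0 * y 0, x 0 * y 1, x 1 * y 0, x 1 * y 1] ⬝ᵥ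
        G *ᵥ ![x 0 * y 0, x 0 * y 1, x 1 * y 0, x 1 * y 1] := by
    intro x y
    simp [hf, hG, hG₀, mulVec, dotProduct, Fin.sum_univ_four]
    ring
  have form : ∀ (M : Matrix (Fin 4) (Fin 4) ℝ) z, M.toQuadraticForm' z = z ⬝ᵥ M *ᵥ z := by
    intro M z
    simp [toQuadraticForm', toLinearMap₂'_apply']
  obtain ⟨c, hc⟩ := G.toQuadraticForm'.exists_isLeast_multiplier B.toQuadraticForm'
    ⟨![1, 0, 0, 1], by simp [form, hBz]⟩ ⟨![0, 1, 1, 0], by simp [form, hBz]⟩ (by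
      intro z hz
      rw [form, hBz] at hz
      obtain ⟨x, y, rfl⟩ := exists_eq_outer_of_mul_eq_mul z hz
      rw [form, ← hGf]
      exact hpsd x y)
  simp only [form] at hc
  obtain ⟨L, hL⟩ := hGs.exists_sum_sq_of_isLeast hBs (C := 1) (by
    intro z
    rw [hBz]
    have hz : z ⬝ᵥ z = z 0 * z 0 + z 1 * z 1 + z 2 * z 2 + z 3 * z 3 := Fin.sum_univ_four _
    rw [hz]
    nlinarith [sq_nonneg (z 0 - z 3), sq_nonneg (z 1 + z 2), sq_nonneg (z 0 + z 3),
      sq_nonneg (z 1 - z 2)]) hc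
  refine ⟨fun t => !![0, 0, L t 0 / 2, L t 1 / 2; 0, 0, L t 2 / 2, L t 3 / 2;
    L t 0 / 2, L t 2 / 2, 0, 0; L t 1 / 2, L t 3 / 2, 0, 0], fun t => ?_, fun x y => ?_⟩
  · ext i j
    fin_cases i <;> fin_cases j <;> rfl
  · have h := hL ![x 0 * y 0, x 0 * y 1, x 1 * y 0, x 1 * y 1]
    have hzero : x 0 * y 0 * (x 1 * y 1) - x 0 * y 1 * (x 1 * y 0) = 0 := by ring
    rw [hBz, ← hGf] at h
    simp only [cons_val, hzero, mul_zero, add_zero] at h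
    rw [h]
    refine Finset.sum_congr rfl fun t _ => congrArg (· ^ 2) ?_
    have e : Fin.append x y = ![x 0, x 1, y 0, y 1] := by
      ext i; fin_cases i <;> rfl
    rw [e]
    simp [mulVec, dotProduct, Fin.sum_univ_four]
    ring
end

section
/- Let f : ℝ² × ℝ² → ℝ be given by f(x,y) = a₁₁x₁²y₁² + a₁₂x₁²y₂² + a₂₁x₂²y₁² + a₂₂x₂²y₂² + b x₁x₂y₁y₂ + c_{x1}x₁²y₁y₂ + c_{x2}x₂²y₁y₂ + c_{y1}x₁x₂y₁² + c_{y2}x₁x₂y₂² with real coefficients, and suppose f(x,y) ≥ 0 for all x, y ∈ ℝ². Then there exist real numbers â₁₁, â₁₂, â₂₁, â₂₂, b̂, ĉ_{x1}, ĉ_{y1} such that the 2×2 biquadratic polynomial h(x,y) = â₁₁x₁²y₁² + â₁₂x₁²y₂² + â₂₁x₂²y₁² + â₂₂x₂²y₂² + b̂ x₁x₂y₁y₂ + ĉ_{x1}x₁²y₁y₂ + ĉ_{y1}x₁x₂y₁² (having only the two neighbor half-cross terms x₁²y₁y₂ and x₁x₂y₁²) satisfies: h(x,y) ≥ 0 for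 all x, y ∈ ℝ², and if h is a sum of squares of bilinear forms then f is a sum of squares of bilinear forms. -/
/-- A function of `(x₁,x₂,y₁,y₂)` is a sum of squares of bilinear forms. -/
def IsSOSBilinear22 (f : ℝ → ℝ → ℝ → ℝ → ℝ) : Prop :=
  ∃ (T : ℕ) (c : Fin T → Fin 4 → ℝ), ∀ x1 x2 y1 y2 : ℝ,
    f x1 x2 y1 y2 =
      ∑ t, (c t 0 * (x1 * y1) + c t 1 * (x1 * y2) + c t 2 * (x2 * y1) + c t 3 * (x2 * y2)) ^ 2

/-- Sums of squares of bilinear forms are preserved by linear substitutions in `x` and in `y`. -/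
theorem IsSOSBilinear22.comp_linear {f : ℝ → ℝ → ℝ → ℝ → ℝ} (hf : IsSOSBilinear22 f)
    (k11 k12 k21 k22 l11 l12 l21 l22 : ℝ) :
    IsSOSBilinear22 fun x1 x2 y1 y2 =>
      f (k11 * x1 + k12 * x2) (k21 * x1 + k22 * x2)
        (l11 * y1 + l12 * y2) (l21 * y1 + l22 * y2) := by
  obtain ⟨T, c, hc⟩ := hf
  refine ⟨T, fun t => ![
    c t 0 * k11 * l11 + c t 1 * k11 * l21 + c t 2 * k21 * l11 + c t 3 * k21 * l21,
    c t 0 * k11 * l12 + c t 1 * k11 * l22 + c t 2 * k21 * l12 + c t 3 * k21 * l22,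
    c t 0 * k12 * l11 + c t 1 * k12 * l21 + c t 2 * k22 * l11 + c t 3 * k22 * l21,
    c t 0 * k12 * l12 + c t 1 * k12 * l22 + c t 2 * k22 * l12 + c t 3 * k22 * l22],
    fun x1 x2 y1 y2 => ?_⟩
  refine (hc _ _ _ _).trans (Finset.sum_congr rfl fun t _ => ?_)
  simp only [Matrix.cons_val]
  ring

theorem eq_zero_of_forall_sq_mul_add_mul_nonneg {a c : ℝ}
    (h : ∀ t : ℝ, 0 ≤ a * t ^ 2 + c * t) : c = 0 := by
  have hd : discrim a c 0 ≤ 0 := discrim_le_zero fun t => by linarith [h t, sq t]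
  have hc : c ^ 2 ≤ 0 := by simpa [discrim] using hd
  exact pow_eq_zero_iff two_ne_zero |>.mp (le_antisymm hc (sq_nonneg c))

/-- First-order condition for a binary quadratic form at a minimizer on the unit circle. -/
theorem quadratic_polar_eq_zero_of_min_on_circle {A B C r w : ℝ} (hrw : r ^ 2 + w ^ 2 = 1)
    (hmin : ∀ y1 y2 : ℝ, y1 ^ 2 + y2 ^ 2 = 1 →
      A * r ^ 2 + B * r * w + C * w ^ 2 ≤ A * y1 ^ 2 + B * y1 * y2 + C * y2 ^ 2) :
    2 * A * w * r + B * (w ^ 2 - r ^ 2) - 2 * C * r * w = 0 := by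
  refine eq_zero_of_forall_sq_mul_add_mul_nonneg
    (a := A * w ^ 2 - B * r * w + C * r ^ 2 - (A * r ^ 2 + B * r * w + C * w ^ 2)) fun t => ?_
  have hn : 0 < 1 + t ^ 2 := by positivity
  have hs : √(1 + t ^ 2) ^ 2 = 1 + t ^ 2 := Real.sq_sqrt hn.le
  have hs0 : √(1 + t ^ 2) ≠ 0 := (Real.sqrt_pos.mpr hn).ne'
  set s := √(1 + t ^ 2)
  have key := hmin ((w * t + r) / s) ((-r * t + w) / s) (by
    field_simp
    rw [hs]
    linear_combination (1 + t ^ 2) * hrw)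
  have hq : A * ((w * t + r) / s) ^ 2 + B * ((w * t + r) / s) * ((-r * t + w) / s) +
      C * ((-r * t + w) / s) ^ 2 =
      (A * (w * t + r) ^ 2 + B * (w * t + r) * (-r * t + w) + C * (-r * t + w) ^ 2) /
        (1 + t ^ 2) := by
    rw [← hs]
    field_simp
  rw [hq, le_div_iff₀ hn] at key
  linarith

theorem isCompact_unit_circle : IsCompact {x : ℝ × ℝ | x.1 ^ 2 + x.2 ^ 2 = 1} := by
  refine (isCompact_Icc (a := ((-1, -1) : ℝ × ℝ)) (b := (1, 1))).of_isClosed_subset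
    (isClosed_eq (by fun_prop) continuous_const) fun x hx => ?_
  have hx : x.1 ^ 2 + x.2 ^ 2 = 1 := hx
  have h1 := abs_le.mp (abs_le_one_iff_mul_self_le_one.mpr
    (by nlinarith [sq_nonneg x.2] : x.1 * x.1 ≤ 1))
  have h2 := abs_le.mp (abs_le_one_iff_mul_self_le_one.mpr
    (by nlinarith [sq_nonneg x.1] : x.2 * x.2 ≤ 1))
  exact ⟨⟨h1.1, h2.1⟩, ⟨h1.2, h2.2⟩⟩

/-- The general 2×2 biquadratic polynomial. -/
def biquadratic22 (a11 a12 a21 a22 b cx1 cx2 cy1 cy2 x1 x2 y1 y2 : ℝ) : ℝ :=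
  a11 * x1 ^ 2 * y1 ^ 2 + a12 * x1 ^ 2 * y2 ^ 2 + a21 * x2 ^ 2 * y1 ^ 2 +
    a22 * x2 ^ 2 * y2 ^ 2 + b * x1 * x2 * y1 * y2 + cx1 * x1 ^ 2 * y1 * y2 +
    cx2 * x2 ^ 2 * y1 * y2 + cy1 * x1 * x2 * y1 ^ 2 + cy2 * x1 * x2 * y2 ^ 2

theorem exists_min_biquadratic22 (a11 a12 a21 a22 b cx1 cx2 cy1 cy2 : ℝ) :
    ∃ p q r w : ℝ, p ^ 2 + q ^ 2 = 1 ∧ r ^ 2 + w ^ 2 = 1 ∧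
      ∀ x1 x2 y1 y2 : ℝ, x1 ^ 2 + x2 ^ 2 = 1 → y1 ^ 2 + y2 ^ 2 = 1 →
        biquadratic22 a11 a12 a21 a22 b cx1 cx2 cy1 cy2 p q r w ≤
          biquadratic22 a11 a12 a21 a22 b cx1 cx2 cy1 cy2 x1 x2 y1 y2 := by
  have hcont : Continuous fun z : (ℝ × ℝ) × (ℝ × ℝ) =>
      biquadratic22 a11 a12 a21 a22 b cx1 cx2 cy1 cy2 z.1.1 z.1.2 z.2.1 z.2.2 := by
    unfold biquadratic22
    fun_prop
  obtain ⟨z, hz, hmin⟩ := (isCompact_unit_circle.prod isCompact_unit_circle).exists_isMinOn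
    ⟨((1, 0), (1, 0)), by simp⟩ hcont.continuousOn
  rw [isMinOn_iff] at hmin
  exact ⟨z.1.1, z.1.2, z.2.1, z.2.2, hz.1, hz.2, fun x1 x2 y1 y2 hx hy =>
    hmin ((x1, x2), (y1, y2)) ⟨hx, hy⟩⟩

/-- For every PSD 2×2 biquadratic polynomial `f` there is a PSD 2×2
biquadratic polynomial `h` with only the two neighbor half-cross terms `x₁²y₁y₂` and
`x₁x₂y₁²`, such that if `h` is SOS then `f` is SOS. -/
theorem psd_2x2_reduce_to_two_neighbor_half_cross (a11 a12 a21 a22 b cx1 cx2 cy1 cy2 : ℝ)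
    (hpsd : ∀ x1 x2 y1 y2 : ℝ,
      0 ≤ a11 * x1 ^ 2 * y1 ^ 2 + a12 * x1 ^ 2 * y2 ^ 2 + a21 * x2 ^ 2 * y1 ^ 2 +
          a22 * x2 ^ 2 * y2 ^ 2 + b * x1 * x2 * y1 * y2 + cx1 * x1 ^ 2 * y1 * y2 +
          cx2 * x2 ^ 2 * y1 * y2 + cy1 * x1 * x2 * y1 ^ 2 + cy2 * x1 * x2 * y2 ^ 2) :
    ∃ A11 A12 A21 A22 B Cx1 Cy1 : ℝ,
      (∀ x1 x2 y1 y2 : ℝ,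
        0 ≤ A11 * x1 ^ 2 * y1 ^ 2 + A12 * x1 ^ 2 * y2 ^ 2 + A21 * x2 ^ 2 * y1 ^ 2 +
            A22 * x2 ^ 2 * y2 ^ 2 + B * x1 * x2 * y1 * y2 + Cx1 * x1 ^ 2 * y1 * y2 +
            Cy1 * x1 * x2 * y1 ^ 2) ∧
      (IsSOSBilinear22 (fun x1 x2 y1 y2 =>
          A11 * x1 ^ 2 * y1 ^ 2 + A12 * x1 ^ 2 * y2 ^ 2 + A21 * x2 ^ 2 * y1 ^ 2 +
          A22 * x2 ^ 2 * y2 ^ 2 + B * x1 * x2 * y1 * y2 + Cx1 * x1 ^ 2 * y1 * y2 +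
          Cy1 * x1 * x2 * y1 ^ 2) →
        IsSOSBilinear22 (fun x1 x2 y1 y2 =>
          a11 * x1 ^ 2 * y1 ^ 2 + a12 * x1 ^ 2 * y2 ^ 2 + a21 * x2 ^ 2 * y1 ^ 2 +
          a22 * x2 ^ 2 * y2 ^ 2 + b * x1 * x2 * y1 * y2 + cx1 * x1 ^ 2 * y1 * y2 +
          cx2 * x2 ^ 2 * y1 * y2 + cy1 * x1 * x2 * y1 ^ 2 + cy2 * x1 * x2 * y2 ^ 2)) := by
  obtain ⟨p, q, r, w, hpq, hrw, hmin⟩ :=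
    exists_min_biquadratic22 a11 a12 a21 a22 b cx1 cx2 cy1 cy2
  set F := biquadratic22 a11 a12 a21 a22 b cx1 cx2 cy1 cy2 with hF
  have hCx2 := quadratic_polar_eq_zero_of_min_on_circle
    (A := a11 * p ^ 2 + a21 * q ^ 2 + cy1 * p * q)
    (B := cx1 * p ^ 2 + cx2 * q ^ 2 + b * p * q)
    (C := a12 * p ^ 2 + a22 * q ^ 2 + cy2 * p * q) hrw fun y1 y2 hy => by
      have := hmin p q y1 y2 hpq hy
      simp only [hF, biquadratic22] at this
      linarith
  have hCy2 := quadratic_polar_eq_zero_of_min_on_circle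
    (A := a11 * r ^ 2 + a12 * w ^ 2 + cx1 * r * w)
    (B := cy1 * r ^ 2 + cy2 * w ^ 2 + b * r * w)
    (C := a21 * r ^ 2 + a22 * w ^ 2 + cx2 * r * w) hpq fun x1 x2 hx => by
      have := hmin x1 x2 r w hx hrw
      simp only [hF, biquadratic22] at this
      linarith
  let H : ℝ → ℝ → ℝ → ℝ → ℝ := fun u1 u2 v1 v2 =>
    F (q * u1 + p * u2) (-p * u1 + q * u2) (w * v1 + r * v2) (-r * v1 + w * v2)
  have hH : ∀ u1 u2 v1 v2 : ℝ,
      H 1 0 1 0 * u1 ^ 2 * v1 ^ 2 + H 1 0 0 1 * u1 ^ 2 * v2 ^ 2 + H 0 1 1 0 * u2 ^ 2 * v1 ^ 2 +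
        H 0 1 0 1 * u2 ^ 2 * v2 ^ 2 +
        (H 1 1 1 1 - H 1 1 1 (-1) - H 1 (-1) 1 1 + H 1 (-1) 1 (-1)) / 4 * u1 * u2 * v1 * v2 +
        (H 1 0 1 1 - H 1 0 1 (-1)) / 2 * u1 ^ 2 * v1 * v2 +
        (H 1 1 1 0 - H 1 (-1) 1 0) / 2 * u1 * u2 * v1 ^ 2 = H u1 u2 v1 v2 := by
    intro u1 u2 v1 v2
    simp only [H, hF, biquadratic22]
    linear_combination (-u2 ^ 2 * v1 * v2) * hCx2 - u1 * u2 * v2 ^ 2 * hCy2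
  refine ⟨_, _, _, _, _, _, _, fun u1 u2 v1 v2 => (hpsd _ _ _ _).trans_eq
    (hH u1 u2 v1 v2).symm, fun hsos => ?_⟩
  simp only [hH] at hsos
  convert hsos.comp_linear q (-p) p q w (-r) r w using 5 with x1 x2 y1 y2
  change F x1 x2 y1 y2 = F _ _ _ _
  congr 1
  · linear_combination -x1 * hpq
  · linear_combination -x2 * hpq
  · linear_combination -y1 * hrw
  · linear_combination -y2 * hrw
end

section
/- Let a₁₁, a₁₂, a₂₁, a₂₂ ∈ ℝ and define f : ℝ² × ℝ² → ℝ by f(x,y) = a₁₁x₁²y₁² + a₁₂x₁²y₂² + a₂₁x₂²y₁² + a₂₂x₂²y₂² − 4x₁x₂y₁y₂. Then the following three statements are equivalent: (a) f(x,y) ≥ 0 for all x, y ∈ ℝ²; (b) f is a sum of squares of bilinear forms; (c) a₁₁ ≥ 0, a₁₂ ≥ 0, a₂₁ ≥ 0, a₂₂ ≥ 0, and √(a₁₁a₂₂) + √(a₁₂a₂₁) ≥ 2. -/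
/-- The minimising choice of `x`, `y` when the four coefficients are `p², q², r², s²`. -/
lemma two_le_mul_add_mul_of_psd {p q r s : ℝ} (hp : 0 < p) (hq : 0 < q) (hr : 0 < r) (hs : 0 < s)
    (h : ∀ x1 x2 y1 y2 : ℝ,
      0 ≤ p ^ 2 * x1 ^ 2 * y1 ^ 2 + q ^ 2 * x1 ^ 2 * y2 ^ 2 + r ^ 2 * x2 ^ 2 * y1 ^ 2 +
        s ^ 2 * x2 ^ 2 * y2 ^ 2 - 4 * (x1 * x2 * y1 * y2)) :
    2 ≤ p * s + q * r := by
  have key := h (√(s * r)) (√(p * q)) (√(s * q)) (√(p * r))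
  have hm : √(s * r) * √(p * q) * √(s * q) * √(p * r) = p * q * r * s := by
    rw [← Real.sqrt_mul (by positivity), ← Real.sqrt_mul (by positivity),
      ← Real.sqrt_mul (by positivity)]
    rw [show s * r * (p * q) * (s * q) * (p * r) = (p * q * r * s) ^ 2 by ring,
      Real.sqrt_sq (by positivity)]
  rw [hm, Real.sq_sqrt (by positivity), Real.sq_sqrt (by positivity),
    Real.sq_sqrt (by positivity), Real.sq_sqrt (by positivity)] at key
  have hpos : 0 < 2 * (p * q * r * s) := by positivity
  have : 0 ≤ 2 * (p * q * r * s) * (p * s + q * r - 2) := by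
    linear_combination key
  linarith [nonneg_of_mul_nonneg_right this hpos]

lemma two_le_sqrt_add_sqrt_of_psd {a b c d : ℝ} (ha : 0 ≤ a) (hb : 0 ≤ b) (hc : 0 ≤ c)
    (hd : 0 ≤ d)
    (h : ∀ x1 x2 y1 y2 : ℝ,
      0 ≤ a * x1 ^ 2 * y1 ^ 2 + b * x1 ^ 2 * y2 ^ 2 + c * x2 ^ 2 * y1 ^ 2 +
        d * x2 ^ 2 * y2 ^ 2 - 4 * (x1 * x2 * y1 * y2)) :
    2 ≤ √(a * d) + √(b * c) := by
  have hε : ∀ ε ∈ Set.Ioi (0 : ℝ),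
      2 ≤ √((a + ε) * (d + ε)) + √((b + ε) * (c + ε)) := by
    intro ε hε
    have hε : 0 < ε := hε
    rw [Real.sqrt_mul (by positivity), Real.sqrt_mul (by positivity)]
    refine two_le_mul_add_mul_of_psd (by positivity) (by positivity) (by positivity)
      (by positivity) fun x1 x2 y1 y2 => ?_
    rw [Real.sq_sqrt (by positivity), Real.sq_sqrt (by positivity),
      Real.sq_sqrt (by positivity), Real.sq_sqrt (by positivity)]
    have hnn : 0 ≤ ε * ((x1 ^ 2 + x2 ^ 2) * (y1 ^ 2 + y2 ^ 2)) := by positivity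
    linear_combination h x1 x2 y1 y2 + hnn
  have hcont : Continuous fun ε : ℝ => √((a + ε) * (d + ε)) + √((b + ε) * (c + ε)) := by
    fun_prop
  have hlim := (hcont.tendsto 0).mono_left (nhdsWithin_le_nhds (s := Set.Ioi (0 : ℝ)))
  simp only [add_zero] at hlim
  exact ge_of_tendsto hlim (eventually_mem_nhdsWithin.mono hε)

lemma isSOSBilinear22_of_two_le {a b c d : ℝ} (ha : 0 ≤ a) (hb : 0 ≤ b) (hc : 0 ≤ c)
    (hd : 0 ≤ d) (h : 2 ≤ √(a * d) + √(b * c)) :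
    IsSOSBilinear22 (fun x1 x2 y1 y2 =>
      a * x1 ^ 2 * y1 ^ 2 + b * x1 ^ 2 * y2 ^ 2 + c * x2 ^ 2 * y1 ^ 2 +
        d * x2 ^ 2 * y2 ^ 2 - 4 * (x1 * x2 * y1 * y2)) := by
  rw [Real.sqrt_mul ha, Real.sqrt_mul hb] at h
  obtain ⟨p, hp⟩ : ∃ p, p = √a := ⟨_, rfl⟩
  obtain ⟨q, hq⟩ : ∃ q, q = √b := ⟨_, rfl⟩
  obtain ⟨r, hr⟩ : ∃ r, r = √c := ⟨_, rfl⟩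
  obtain ⟨s, hs⟩ : ∃ s, s = √d := ⟨_, rfl⟩
  have ha' : a = p ^ 2 := by rw [hp, Real.sq_sqrt ha]
  have hb' : b = q ^ 2 := by rw [hq, Real.sq_sqrt hb]
  have hc' : c = r ^ 2 := by rw [hr, Real.sq_sqrt hc]
  have hd' : d = s ^ 2 := by rw [hs, Real.sq_sqrt hd]
  rw [← hp, ← hq, ← hr, ← hs] at h
  obtain ⟨θ, hθ0, hθ1, hθ⟩ : ∃ θ : ℝ, 0 ≤ θ ∧ θ ≤ 1 ∧ θ * (p * s + q * r) = 2 :=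
    ⟨2 / (p * s + q * r), div_nonneg zero_le_two (by linarith),
      (div_le_one (by linarith)).2 h, div_mul_cancel₀ _ (by linarith)⟩
  obtain ⟨k, hk⟩ : ∃ k, k ^ 2 = θ := ⟨√θ, Real.sq_sqrt hθ0⟩
  obtain ⟨l, hl⟩ : ∃ l, l ^ 2 = 1 - θ := ⟨√(1 - θ), Real.sq_sqrt (by linarith)⟩
  refine ⟨6, ![![k * p, 0, 0, -(k * s)], ![0, k * q, -(k * r), 0], ![l * p, 0, 0, 0],
    ![0, l * q, 0, 0], ![0, 0, l * r, 0], ![0, 0, 0, l * s]], fun x1 x2 y1 y2 => ?_⟩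
  simp [Fin.sum_univ_succ]
  subst ha' hb' hc' hd'
  linear_combination
    (-((p * (x1 * y1) - s * (x2 * y2)) ^ 2 + (q * (x1 * y2) - r * (x2 * y1)) ^ 2)) * hk -
    ((p * (x1 * y1)) ^ 2 + (q * (x1 * y2)) ^ 2 + (r * (x2 * y1)) ^ 2 + (s * (x2 * y2)) ^ 2) * hl +
    2 * (x1 * x2 * y1 * y2) * hθ

/-- For `f = a₁₁x₁²y₁² + a₁₂x₁²y₂² + a₂₁x₂²y₁² + a₂₂x₂²y₂² − 4x₁x₂y₁y₂`,
PSD, SOS, and the coefficient condition are all equivalent. -/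
theorem psd_iff_sos_iff_coeff_full_cross_four (a11 a12 a21 a22 : ℝ) :
    ((∀ x1 x2 y1 y2 : ℝ,
        0 ≤ a11 * x1 ^ 2 * y1 ^ 2 + a12 * x1 ^ 2 * y2 ^ 2 + a21 * x2 ^ 2 * y1 ^ 2 +
            a22 * x2 ^ 2 * y2 ^ 2 - 4 * (x1 * x2 * y1 * y2)) ↔
      IsSOSBilinear22 (fun x1 x2 y1 y2 =>
        a11 * x1 ^ 2 * y1 ^ 2 + a12 * x1 ^ 2 * y2 ^ 2 + a21 * x2 ^ 2 * y1 ^ 2 +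
        a22 * x2 ^ 2 * y2 ^ 2 - 4 * (x1 * x2 * y1 * y2))) ∧
    (IsSOSBilinear22 (fun x1 x2 y1 y2 =>
        a11 * x1 ^ 2 * y1 ^ 2 + a12 * x1 ^ 2 * y2 ^ 2 + a21 * x2 ^ 2 * y1 ^ 2 +
        a22 * x2 ^ 2 * y2 ^ 2 - 4 * (x1 * x2 * y1 * y2)) ↔
      (0 ≤ a11 ∧ 0 ≤ a12 ∧ 0 ≤ a21 ∧ 0 ≤ a22 ∧
        2 ≤ Real.sqrt (a11 * a22) + Real.sqrt (a12 * a21))) := by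
  have hsos : IsSOSBilinear22 (fun x1 x2 y1 y2 =>
        a11 * x1 ^ 2 * y1 ^ 2 + a12 * x1 ^ 2 * y2 ^ 2 + a21 * x2 ^ 2 * y1 ^ 2 +
        a22 * x2 ^ 2 * y2 ^ 2 - 4 * (x1 * x2 * y1 * y2)) →
      ∀ x1 x2 y1 y2 : ℝ,
        0 ≤ a11 * x1 ^ 2 * y1 ^ 2 + a12 * x1 ^ 2 * y2 ^ 2 + a21 * x2 ^ 2 * y1 ^ 2 +
            a22 * x2 ^ 2 * y2 ^ 2 - 4 * (x1 * x2 * y1 * y2) := by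
    rintro ⟨T, c, hc⟩ x1 x2 y1 y2
    exact (Finset.sum_nonneg fun t _ => sq_nonneg _).trans_eq (hc x1 x2 y1 y2).symm
  have hcoeff : (∀ x1 x2 y1 y2 : ℝ,
        0 ≤ a11 * x1 ^ 2 * y1 ^ 2 + a12 * x1 ^ 2 * y2 ^ 2 + a21 * x2 ^ 2 * y1 ^ 2 +
            a22 * x2 ^ 2 * y2 ^ 2 - 4 * (x1 * x2 * y1 * y2)) →
      0 ≤ a11 ∧ 0 ≤ a12 ∧ 0 ≤ a21 ∧ 0 ≤ a22 ∧
        2 ≤ Real.sqrt (a11 * a22) + Real.sqrt (a12 * a21) := by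
    intro h
    have h11 : 0 ≤ a11 := by simpa using h 1 0 1 0
    have h12 : 0 ≤ a12 := by simpa using h 1 0 0 1
    have h21 : 0 ≤ a21 := by simpa using h 0 1 1 0
    have h22 : 0 ≤ a22 := by simpa using h 0 1 0 1
    exact ⟨h11, h12, h21, h22, two_le_sqrt_add_sqrt_of_psd h11 h12 h21 h22 h⟩
  have hform := fun h : 0 ≤ a11 ∧ 0 ≤ a12 ∧ 0 ≤ a21 ∧ 0 ≤ a22 ∧
      2 ≤ Real.sqrt (a11 * a22) + Real.sqrt (a12 * a21) =>
    isSOSBilinear22_of_two_le h.1 h.2.1 h.2.2.1 h.2.2.2.1 h.2.2.2.2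
  exact ⟨⟨fun h => hform (hcoeff h), hsos⟩, ⟨fun h => hcoeff (hsos h), hform⟩⟩
end

section
/- Let a₁₁, a₁₂, a₂₁, a₂₂, b ∈ ℝ and define f : ℝ² × ℝ² → ℝ by f(x,y) = a₁₁x₁²y₁² + a₁₂x₁²y₂² + a₂₁x₂²y₁² + a₂₂x₂²y₂² − b x₁x₂y₁y₂. Then the following three statements are equivalent: (a) f(x,y) ≥ 0 for all x, y ∈ ℝ²; (b) f is a sum of squares of bilinear forms; (c) a₁₁ ≥ 0, a₁₂ ≥ 0, a₂₁ ≥ 0, a₂₂ ≥ 0, and √(a₁₁a₂₂) + √(a₁₂a₂₁) ≥ |b|/2. -/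
/-- A nonnegative biquadratic form with diagonal terms and a full-cross term has a bounded cross
coefficient, when its diagonal coefficients are dominated by squares of positive numbers. -/
lemma le_two_mul_add_of_nonneg {a11 a12 a21 a22 b p q r s : ℝ}
    (h : ∀ x1 x2 y1 y2 : ℝ,
        0 ≤ a11 * x1 ^ 2 * y1 ^ 2 + a12 * x1 ^ 2 * y2 ^ 2 + a21 * x2 ^ 2 * y1 ^ 2 +
            a22 * x2 ^ 2 * y2 ^ 2 - b * (x1 * x2 * y1 * y2))
    (hp : 0 < p) (hq : 0 < q) (hr : 0 < r) (hs : 0 < s)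
    (h11 : a11 ≤ p ^ 2) (h12 : a12 ≤ q ^ 2) (h21 : a21 ≤ r ^ 2) (h22 : a22 ≤ s ^ 2) :
    b ≤ 2 * (p * s + q * r) := by
  obtain ⟨P, hP, rfl⟩ : ∃ P : ℝ, 0 < P ∧ p = P ^ 2 :=
    ⟨√p, Real.sqrt_pos.2 hp, (Real.sq_sqrt hp.le).symm⟩
  obtain ⟨Q, hQ, rfl⟩ : ∃ Q : ℝ, 0 < Q ∧ q = Q ^ 2 :=
    ⟨√q, Real.sqrt_pos.2 hq, (Real.sq_sqrt hq.le).symm⟩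
  obtain ⟨R, hR, rfl⟩ : ∃ R : ℝ, 0 < R ∧ r = R ^ 2 :=
    ⟨√r, Real.sqrt_pos.2 hr, (Real.sq_sqrt hr.le).symm⟩
  obtain ⟨S, hS, rfl⟩ : ∃ S : ℝ, 0 < S ∧ s = S ^ 2 :=
    ⟨√s, Real.sqrt_pos.2 hs, (Real.sq_sqrt hs.le).symm⟩
  have key := h (S * R) (P * Q) (S * Q) (P * R)
  have e11 := mul_le_mul_of_nonneg_right h11 (sq_nonneg (S * R * (S * Q)))
  have e12 := mul_le_mul_of_nonneg_right h12 (sq_nonneg (S * R * (P * R)))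
  have e21 := mul_le_mul_of_nonneg_right h21 (sq_nonneg (P * Q * (S * Q)))
  have e22 := mul_le_mul_of_nonneg_right h22 (sq_nonneg (P * Q * (P * R)))
  have hpos : 0 < (P * Q * R * S) ^ 2 := by positivity
  refine le_of_mul_le_mul_right ?_ hpos
  linarith

/-- The coefficient conditions satisfied by a nonnegative form. -/
lemma coeff_of_nonneg {a11 a12 a21 a22 b : ℝ}
    (h : ∀ x1 x2 y1 y2 : ℝ,
        0 ≤ a11 * x1 ^ 2 * y1 ^ 2 + a12 * x1 ^ 2 * y2 ^ 2 + a21 * x2 ^ 2 * y1 ^ 2 +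
            a22 * x2 ^ 2 * y2 ^ 2 - b * (x1 * x2 * y1 * y2)) :
    0 ≤ a11 ∧ 0 ≤ a12 ∧ 0 ≤ a21 ∧ 0 ≤ a22 ∧
      |b| / 2 ≤ Real.sqrt (a11 * a22) + Real.sqrt (a12 * a21) := by
  have h11 : 0 ≤ a11 := by simpa using h 1 0 1 0
  have h12 : 0 ≤ a12 := by simpa using h 1 0 0 1
  have h21 : 0 ≤ a21 := by simpa using h 0 1 1 0
  have h22 : 0 ≤ a22 := by simpa using h 0 1 0 1
  refine ⟨h11, h12, h21, h22, ?_⟩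
  have hneg : ∀ x1 x2 y1 y2 : ℝ,
      0 ≤ a11 * x1 ^ 2 * y1 ^ 2 + a12 * x1 ^ 2 * y2 ^ 2 + a21 * x2 ^ 2 * y1 ^ 2 +
          a22 * x2 ^ 2 * y2 ^ 2 - (-b) * (x1 * x2 * y1 * y2) := fun x1 x2 y1 y2 => by
    linarith [h (-x1) x2 y1 y2]
  have hε : ∀ ε : ℝ, 0 < ε →
      |b| ≤ 2 * ((√a11 + ε) * (√a22 + ε) + (√a12 + ε) * (√a21 + ε)) := fun ε hε => by
    have pos (a : ℝ) : 0 < √a + ε := by positivity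
    have dom {a : ℝ} (ha : 0 ≤ a) : a ≤ (√a + ε) ^ 2 := by
      nlinarith [Real.sq_sqrt ha, Real.sqrt_nonneg a]
    exact abs_le'.2
      ⟨le_two_mul_add_of_nonneg h (pos _) (pos _) (pos _) (pos _)
        (dom h11) (dom h12) (dom h21) (dom h22),
      le_two_mul_add_of_nonneg hneg (pos _) (pos _) (pos _) (pos _)
        (dom h11) (dom h12) (dom h21) (dom h22)⟩
  have hcont : Continuous fun ε : ℝ =>
      2 * ((√a11 + ε) * (√a22 + ε) + (√a12 + ε) * (√a21 + ε)) := by fun_prop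
  have hlim := ge_of_tendsto ((hcont.tendsto 0).mono_left nhdsWithin_le_nhds)
    (Filter.eventually_of_mem (self_mem_nhdsWithin (s := Set.Ioi (0 : ℝ))) hε)
  rw [Real.sqrt_mul h11, Real.sqrt_mul h12]
  simp only [add_zero] at hlim
  linarith

/-- The coefficient conditions yield an explicit decomposition into four squares. -/
lemma isSOSBilinear22_of_coeff {a11 a12 a21 a22 b : ℝ}
    (h11 : 0 ≤ a11) (h12 : 0 ≤ a12) (h21 : 0 ≤ a21) (h22 : 0 ≤ a22)
    (hb : |b| / 2 ≤ Real.sqrt (a11 * a22) + Real.sqrt (a12 * a21)) :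
    IsSOSBilinear22 (fun x1 x2 y1 y2 =>
        a11 * x1 ^ 2 * y1 ^ 2 + a12 * x1 ^ 2 * y2 ^ 2 + a21 * x2 ^ 2 * y1 ^ 2 +
        a22 * x2 ^ 2 * y2 ^ 2 - b * (x1 * x2 * y1 * y2)) := by
  rw [Real.sqrt_mul h11, Real.sqrt_mul h12] at hb
  obtain ⟨θ, hθ, hbθ⟩ : ∃ θ : ℝ, |θ| ≤ 1 ∧ b = 2 * θ * (√a11 * √a22 + √a12 * √a21) := by
    have hnonneg : 0 ≤ √a11 * √a22 + √a12 * √a21 := by positivity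
    generalize √a11 * √a22 + √a12 * √a21 = m at hb hnonneg
    obtain rfl | hm := hnonneg.eq_or_lt
    · refine ⟨0, by simp, ?_⟩
      have : b = 0 := abs_nonpos_iff.1 (by linarith)
      simp [this]
    · refine ⟨b / (2 * m), ?_, by field_simp⟩
      rw [abs_div, abs_of_pos (by positivity : 0 < 2 * m), div_le_one (by positivity)]
      linarith
  have hsq : √(1 - θ ^ 2) ^ 2 = 1 - θ ^ 2 :=
    Real.sq_sqrt (sub_nonneg.2 ((sq_le_one_iff_abs_le_one θ).2 hθ))
  refine ⟨4, ![![√a11, 0, 0, -(θ * √a22)], ![0, 0, 0, √(1 - θ ^ 2) * √a22],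
    ![0, √a12, -(θ * √a21), 0], ![0, 0, √(1 - θ ^ 2) * √a21, 0]], fun x1 x2 y1 y2 => ?_⟩
  simp only [Fin.sum_univ_four, Matrix.cons_val]
  linear_combination -(x1 * y1) ^ 2 * Real.sq_sqrt h11 - (x1 * y2) ^ 2 * Real.sq_sqrt h12
    - (x2 * y1) ^ 2 * Real.sq_sqrt h21 - (x2 * y2) ^ 2 * Real.sq_sqrt h22
    - (x1 * x2 * y1 * y2) * hbθ
    - (√a22 ^ 2 * (x2 * y2) ^ 2 + √a21 ^ 2 * (x2 * y1) ^ 2) * hsq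

/-- A sum of squares of bilinear forms is nonnegative. -/
lemma IsSOSBilinear22.nonneg {f : ℝ → ℝ → ℝ → ℝ → ℝ} (hf : IsSOSBilinear22 f)
    (x1 x2 y1 y2 : ℝ) : 0 ≤ f x1 x2 y1 y2 := by
  obtain ⟨T, c, hc⟩ := hf
  rw [hc]
  positivity

/-- For `f = a₁₁x₁²y₁² + a₁₂x₁²y₂² + a₂₁x₂²y₁² + a₂₂x₂²y₂² − b x₁x₂y₁y₂`,
PSD, SOS, and the coefficient condition `√(a₁₁a₂₂)+√(a₁₂a₂₁) ≥ |b|/2` are equivalent. -/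
theorem psd_iff_sos_iff_coeff_full_cross_b (a11 a12 a21 a22 b : ℝ) :
    ((∀ x1 x2 y1 y2 : ℝ,
        0 ≤ a11 * x1 ^ 2 * y1 ^ 2 + a12 * x1 ^ 2 * y2 ^ 2 + a21 * x2 ^ 2 * y1 ^ 2 +
            a22 * x2 ^ 2 * y2 ^ 2 - b * (x1 * x2 * y1 * y2)) ↔
      IsSOSBilinear22 (fun x1 x2 y1 y2 =>
        a11 * x1 ^ 2 * y1 ^ 2 + a12 * x1 ^ 2 * y2 ^ 2 + a21 * x2 ^ 2 * y1 ^ 2 +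
        a22 * x2 ^ 2 * y2 ^ 2 - b * (x1 * x2 * y1 * y2))) ∧
    (IsSOSBilinear22 (fun x1 x2 y1 y2 =>
        a11 * x1 ^ 2 * y1 ^ 2 + a12 * x1 ^ 2 * y2 ^ 2 + a21 * x2 ^ 2 * y1 ^ 2 +
        a22 * x2 ^ 2 * y2 ^ 2 - b * (x1 * x2 * y1 * y2)) ↔
      (0 ≤ a11 ∧ 0 ≤ a12 ∧ 0 ≤ a21 ∧ 0 ≤ a22 ∧
        |b| / 2 ≤ Real.sqrt (a11 * a22) + Real.sqrt (a12 * a21))) := by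
  have hcs := fun hc : 0 ≤ a11 ∧ 0 ≤ a12 ∧ 0 ≤ a21 ∧ 0 ≤ a22 ∧
      |b| / 2 ≤ Real.sqrt (a11 * a22) + Real.sqrt (a12 * a21) =>
    isSOSBilinear22_of_coeff hc.1 hc.2.1 hc.2.2.1 hc.2.2.2.1 hc.2.2.2.2
  exact ⟨⟨fun h => hcs (coeff_of_nonneg h), fun h => h.nonneg⟩,
    ⟨fun h => coeff_of_nonneg h.nonneg, hcs⟩⟩
end

section
/- Let a₁₁, a₁₂, a₂₁, a₂₂ > 0 and b, c ∈ ℝ with c ≠ 0, and define f : ℝ² × ℝ² → ℝ by f(x,y) = a₁₁x₁²y₁² + a₁₂x₁²y₂² + a₂₁x₂²y₁² + a₂₂x₂²y₂² − b x₁x₂y₁y₂ − c x₁x₂y₁². Then the following three statements are equivalent: (a) f(x,y) ≥ 0 for all x, y ∈ ℝ²; (b) f is a sum of squares of bilinear forms; (c) there exists t ∈ ℝ with c²/(4a₂₁) ≤ t ≤ a₁₁ such that √((a₁₁ − t)a₂₂) + √(a₁₂(a₂₁ − c²/(4t))) ≥ |b|/2 (i.e., the maximum of g(t) := √((a₁₁−t)a₂₂)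 + √(a₁₂(a₂₁−c²/(4t))) over the interval [c²/(4a₂₁), a₁₁] is at least |b|/2). -/
/-- Completing the square in a binary quadratic form with positive leading coefficient and
nonpositive discriminant, as an explicit sum of two squares. -/
lemma quadratic_eq_add_sq {p q r : ℝ} (hq : 0 < q) (h : r ^ 2 ≤ 4 * p * q) (u v : ℝ) :
    p * u ^ 2 + q * v ^ 2 - r * (u * v) =
      (√q * v - r / (2 * √q) * u) ^ 2 + (√(p - r ^ 2 / (4 * q)) * u) ^ 2 := by
  have hpos : 0 < √q := Real.sqrt_pos.mpr hq
  have hnn : 0 ≤ p - r ^ 2 / (4 * q) := by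
    rw [sub_nonneg, div_le_iff₀ (by positivity)]
    linarith
  rw [mul_pow, Real.sq_sqrt hnn]
  have hsq : √q ^ 2 = q := Real.sq_sqrt hq.le
  generalize √q = w at *
  subst hsq
  field_simp
  ring

/-- A number whose absolute value is at most `2 * (P + R)` splits proportionally to `P` and `R`. -/
lemma exists_mul_add_mul_eq {b P R : ℝ} (hP : 0 ≤ P) (hR : 0 ≤ R) (h : |b| / 2 ≤ P + R) :
    ∃ k : ℝ, k ^ 2 ≤ 4 ∧ b = k * P + k * R := by
  rcases (add_nonneg hP hR).eq_or_lt with h0 | h0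
  · refine ⟨0, by norm_num, ?_⟩
    rw [abs_eq_zero.mp (le_antisymm (by linarith) (abs_nonneg b))]
    ring
  · refine ⟨b / (P + R), ?_, by field_simp⟩
    rw [div_pow, div_le_iff₀ (by positivity), ← sq_abs b]
    nlinarith [abs_nonneg b]

lemma isSOSBilinear22_of_le_sqrt_add_sqrt {a11 a12 a21 a22 b c t : ℝ}
    (h12 : 0 < a12) (h21 : 0 < a21) (h22 : 0 < a22) (hc : c ≠ 0)
    (hct : c ^ 2 / (4 * a21) ≤ t) (ht' : t ≤ a11)
    (h : |b| / 2 ≤ √((a11 - t) * a22) + √(a12 * (a21 - c ^ 2 / (4 * t)))) :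
    IsSOSBilinear22 (fun x1 x2 y1 y2 =>
        a11 * x1 ^ 2 * y1 ^ 2 + a12 * x1 ^ 2 * y2 ^ 2 + a21 * x2 ^ 2 * y1 ^ 2 +
        a22 * x2 ^ 2 * y2 ^ 2 - b * (x1 * x2 * y1 * y2) - c * (x1 * x2 * y1 ^ 2)) := by
  have ht : 0 < t := lt_of_lt_of_le (by positivity) hct
  have htc : c ^ 2 / (4 * t) ≤ a21 := by
    rw [div_le_iff₀ (by positivity)] at hct ⊢
    linarith
  have hP2 := Real.sq_sqrt (mul_nonneg (sub_nonneg.mpr ht') h22.le)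
  have hR2 := Real.sq_sqrt (mul_nonneg h12.le (sub_nonneg.mpr htc))
  obtain ⟨k, hk, hb⟩ := exists_mul_add_mul_eq (Real.sqrt_nonneg _) (Real.sqrt_nonneg _) h
  generalize √((a11 - t) * a22) = P at *
  generalize √(a12 * (a21 - c ^ 2 / (4 * t))) = R at *
  have h1 : (k * P) ^ 2 ≤ 4 * (a11 - t) * a22 := by nlinarith [sq_nonneg P]
  have h2 : (k * R) ^ 2 ≤ 4 * (a21 - c ^ 2 / (4 * t)) * a12 := by nlinarith [sq_nonneg R]
  have h3 : c ^ 2 ≤ 4 * (c ^ 2 / (4 * t)) * t := by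
    apply le_of_eq
    field_simp
  refine ⟨6, ![
    ![-(k * P / (2 * √a22)), 0, 0, √a22],
    ![√(a11 - t - (k * P) ^ 2 / (4 * a22)), 0, 0, 0],
    ![0, √a12, -(k * R / (2 * √a12)), 0],
    ![0, 0, √(a21 - c ^ 2 / (4 * t) - (k * R) ^ 2 / (4 * a12)), 0],
    ![√t, 0, -(c / (2 * √t)), 0],
    ![0, 0, √(c ^ 2 / (4 * t) - c ^ 2 / (4 * t)), 0]], fun x1 x2 y1 y2 => ?_⟩
  have e1 := quadratic_eq_add_sq h22 h1 (x1 * y1) (x2 * y2)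
  have e2 := quadratic_eq_add_sq h12 h2 (x2 * y1) (x1 * y2)
  have e3 := quadratic_eq_add_sq ht h3 (x2 * y1) (x1 * y1)
  simp only [Fin.sum_univ_six, Matrix.cons_val]
  rw [hb]
  linear_combination e1 + e2 + e3

/-- Nonnegativity of the biquadratic form, restricted to `x = (1, s)`, bounds the discriminant of
the resulting binary quadratic form in `y`. -/
lemma sq_mul_sq_le_of_nonneg {a11 a12 a21 a22 b c : ℝ} (h12 : 0 < a12) (h22 : 0 < a22)
    (h : ∀ x1 x2 y1 y2 : ℝ,
        0 ≤ a11 * x1 ^ 2 * y1 ^ 2 + a12 * x1 ^ 2 * y2 ^ 2 + a21 * x2 ^ 2 * y1 ^ 2 +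
            a22 * x2 ^ 2 * y2 ^ 2 - b * (x1 * x2 * y1 * y2) - c * (x1 * x2 * y1 ^ 2)) (s : ℝ) :
    b ^ 2 * s ^ 2 ≤ 4 * (a11 - c * s + a21 * s ^ 2) * (a12 + a22 * s ^ 2) := by
  have hq : 0 < a12 + a22 * s ^ 2 := by positivity
  have := h 1 s (2 * (a12 + a22 * s ^ 2)) (b * s)
  rw [← sub_nonneg]
  refine nonneg_of_mul_nonneg_right (this.trans_eq ?_) hq
  ring

/-- The point where the derivative of `t ↦ √((a₁₁−t)a₂₂) + √(a₁₂(a₂₁−c²/(4t)))` vanishes, with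
denominators cleared. -/
lemma exists_critical_point {a11 a12 a21 a22 c : ℝ} (h12 : 0 < a12) (h21 : 0 < a21)
    (h22 : 0 < a22) (hc : c ≠ 0) (h : c ^ 2 / (4 * a21) ≤ a11) :
    ∃ t ∈ Set.Icc (c ^ 2 / (4 * a21)) a11,
      4 * t ^ 2 * a22 * √(a12 * (a21 - c ^ 2 / (4 * t))) = c ^ 2 * a12 * √((a11 - t) * a22) := by
  have hpos : 0 < c ^ 2 / (4 * a21) := by positivity
  have hne : ∀ t ∈ Set.Icc (c ^ 2 / (4 * a21)) a11, 4 * t ≠ 0 := fun t ht =>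
    mul_ne_zero four_ne_zero (hpos.trans_le ht.1).ne'
  let F : ℝ → ℝ := fun t => 4 * t ^ 2 * a22 * √(a12 * (a21 - c ^ 2 / (4 * t))) -
    c ^ 2 * a12 * √((a11 - t) * a22)
  have hcont : ContinuousOn F (Set.Icc (c ^ 2 / (4 * a21)) a11) := by
    fun_prop (disch := assumption)
  have hleft : F (c ^ 2 / (4 * a21)) ≤ 0 := by
    have : c ^ 2 / (4 * (c ^ 2 / (4 * a21))) = a21 := by field_simp
    simp only [F, this, sub_self, mul_zero, Real.sqrt_zero, zero_sub, neg_nonpos]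
    positivity
  have hright : 0 ≤ F a11 := by
    simp only [F, sub_self, zero_mul, Real.sqrt_zero, mul_zero, sub_zero]
    positivity
  obtain ⟨t, ht, h0⟩ := intermediate_value_Icc h hcont ⟨hleft, hright⟩
  exact ⟨t, ht, sub_eq_zero.mp h0⟩

lemma exists_le_sqrt_add_sqrt_of_nonneg {a11 a12 a21 a22 b c : ℝ} (h12 : 0 < a12) (h21 : 0 < a21)
    (h22 : 0 < a22) (hc : c ≠ 0)
    (h : ∀ x1 x2 y1 y2 : ℝ,
        0 ≤ a11 * x1 ^ 2 * y1 ^ 2 + a12 * x1 ^ 2 * y2 ^ 2 + a21 * x2 ^ 2 * y1 ^ 2 +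
            a22 * x2 ^ 2 * y2 ^ 2 - b * (x1 * x2 * y1 * y2) - c * (x1 * x2 * y1 ^ 2)) :
    ∃ t : ℝ, c ^ 2 / (4 * a21) ≤ t ∧ t ≤ a11 ∧
      |b| / 2 ≤ √((a11 - t) * a22) + √(a12 * (a21 - c ^ 2 / (4 * t))) := by
  have hle : c ^ 2 / (4 * a21) ≤ a11 := by
    rw [← sub_nonneg]
    refine (h 1 (c / (2 * a21)) 1 0).trans_eq ?_
    field_simp
    ring
  obtain ⟨t, ⟨ht, ht'⟩, hcrit⟩ := exists_critical_point h12 h21 h22 hc hle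
  refine ⟨t, ht, ht', ?_⟩
  have hpos : 0 < t := lt_of_lt_of_le (by positivity) ht
  have htc : c ^ 2 / (4 * t) ≤ a21 := by
    rw [div_le_iff₀ (by positivity)] at ht ⊢
    linarith
  have hdisc := sq_mul_sq_le_of_nonneg h12 h22 h (2 * t / c)
  have hP := Real.sqrt_nonneg ((a11 - t) * a22)
  have hR := Real.sqrt_nonneg (a12 * (a21 - c ^ 2 / (4 * t)))
  have hP2 := Real.sq_sqrt (mul_nonneg (sub_nonneg.mpr ht') h22.le)
  have hR2 := Real.sq_sqrt (mul_nonneg h12.le (sub_nonneg.mpr htc))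
  generalize √((a11 - t) * a22) = P at *
  generalize √(a12 * (a21 - c ^ 2 / (4 * t))) = R at *
  have ha11 : a11 = t + P ^ 2 / a22 := by
    rw [hP2]
    field_simp
    ring
  have ha21 : a21 = c ^ 2 / (4 * t) + R ^ 2 / a12 := by
    rw [hR2]
    field_simp
    ring
  have hPeq : P = 4 * t ^ 2 * a22 * R / (c ^ 2 * a12) := by
    rw [hcrit]
    field_simp
  have hs : 0 < (2 * t / c) ^ 2 := by positivity
  have hsq : b ^ 2 ≤ (2 * (P + R)) ^ 2 := by
    refine le_of_mul_le_mul_right (hdisc.trans_eq ?_) hs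
    rw [ha11, ha21, hPeq]
    field_simp
    ring
  have := abs_le_of_sq_le_sq hsq (by positivity)
  linarith

/-- For `f = a₁₁x₁²y₁² + a₁₂x₁²y₂² + a₂₁x₂²y₁² + a₂₂x₂²y₂² − b x₁x₂y₁y₂ − c x₁x₂y₁²`
with positive diagonal coefficients and `c ≠ 0`, PSD, SOS, and the condition that
`g(t) := √((a₁₁−t)a₂₂) + √(a₁₂(a₂₁−c²/(4t)))` attains a value at least `|b|/2` on
`[c²/(4a₂₁), a₁₁]` are all equivalent. -/
theorem psd_iff_sos_iff_max_condition (a11 a12 a21 a22 b c : ℝ)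
    (h11 : 0 < a11) (h12 : 0 < a12) (h21 : 0 < a21) (h22 : 0 < a22) (hc : c ≠ 0) :
    ((∀ x1 x2 y1 y2 : ℝ,
        0 ≤ a11 * x1 ^ 2 * y1 ^ 2 + a12 * x1 ^ 2 * y2 ^ 2 + a21 * x2 ^ 2 * y1 ^ 2 +
            a22 * x2 ^ 2 * y2 ^ 2 - b * (x1 * x2 * y1 * y2) - c * (x1 * x2 * y1 ^ 2)) ↔
      IsSOSBilinear22 (fun x1 x2 y1 y2 =>
        a11 * x1 ^ 2 * y1 ^ 2 + a12 * x1 ^ 2 * y2 ^ 2 + a21 * x2 ^ 2 * y1 ^ 2 +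
        a22 * x2 ^ 2 * y2 ^ 2 - b * (x1 * x2 * y1 * y2) - c * (x1 * x2 * y1 ^ 2))) ∧
    (IsSOSBilinear22 (fun x1 x2 y1 y2 =>
        a11 * x1 ^ 2 * y1 ^ 2 + a12 * x1 ^ 2 * y2 ^ 2 + a21 * x2 ^ 2 * y1 ^ 2 +
        a22 * x2 ^ 2 * y2 ^ 2 - b * (x1 * x2 * y1 * y2) - c * (x1 * x2 * y1 ^ 2)) ↔
      (∃ t : ℝ, c ^ 2 / (4 * a21) ≤ t ∧ t ≤ a11 ∧
        |b| / 2 ≤ Real.sqrt ((a11 - t) * a22) +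
          Real.sqrt (a12 * (a21 - c ^ 2 / (4 * t))))) := by
  have hac := exists_le_sqrt_add_sqrt_of_nonneg (a11 := a11) (b := b) h12 h21 h22 hc
  refine ⟨⟨fun h => ?_, fun h => h.nonneg⟩, fun h => hac h.nonneg, fun ⟨t, ht, ht', h⟩ =>
    isSOSBilinear22_of_le_sqrt_add_sqrt h12 h21 h22 hc ht ht' h⟩
  obtain ⟨t, ht, ht', hb⟩ := hac h
  exact isSOSBilinear22_of_le_sqrt_add_sqrt h12 h21 h22 hc ht ht' hb
end

section
/- Let c > 0 and a₁₁, a₂₂ ∈ ℝ with c² < a₁₁ ≤ (5/4)c², and define f : ℝ² × ℝ² → ℝ by f(x,y) = a₁₁x₁²y₁² + x₁²y₂² + x₂²y₁² + a₂₂x₂²y₂² + 2c x₁²y₁y₂ + 2c x₁x₂y₁². If a₂₂ ≥ 1/(a₁₁ − c²), then f is a sum of squares of bilinear forms. -/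
/-- Case `c_x = c_y = c > 0`, `c² < a₁₁ ≤ (5/4)c²`: if `a₂₂ ≥ 1/(a₁₁ − c²)`
then `f` is SOS. -/
theorem sos_case_i2 (c a11 a22 : ℝ) (hc : 0 < c)
    (ha11l : c ^ 2 < a11) (ha11u : a11 ≤ 5 / 4 * c ^ 2)
    (hcond : 1 / (a11 - c ^ 2) ≤ a22) :
    IsSOSBilinear22 (fun x1 x2 y1 y2 =>
      a11 * x1 ^ 2 * y1 ^ 2 + x1 ^ 2 * y2 ^ 2 + x2 ^ 2 * y1 ^ 2 + a22 * x2 ^ 2 * y2 ^ 2 +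
      2 * c * (x1 ^ 2 * y1 * y2) + 2 * c * (x1 * x2 * y1 ^ 2)) := by
  have hd : 0 < a11 - c ^ 2 := sub_pos.2 ha11l
  obtain ⟨u, hu, hu2⟩ : ∃ u : ℝ, u ≠ 0 ∧ u ^ 2 = a11 - c ^ 2 :=
    ⟨√(a11 - c ^ 2), (Real.sqrt_pos.2 hd).ne', Real.sq_sqrt hd.le⟩
  obtain ⟨v, hv⟩ : ∃ v : ℝ, v ^ 2 = a22 - 1 / (a11 - c ^ 2) :=
    ⟨√(a22 - 1 / (a11 - c ^ 2)), Real.sq_sqrt (sub_nonneg.2 hcond)⟩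
  refine ⟨3, ![![c, 1, 1, 0], ![u, 0, 0, -u⁻¹], ![0, 0, 0, v]], fun x1 x2 y1 y2 => ?_⟩
  obtain rfl : a11 = u ^ 2 + c ^ 2 := by linarith
  obtain rfl : a22 = v ^ 2 + (u ^ 2)⁻¹ := by
    rw [hv, add_sub_cancel_right, one_div, sub_add_cancel]
  simp [Fin.sum_univ_three]
  field_simp
  ring
end

section
/- Let c_x ≥ c_y > 0 and a₂₂ > 0, and define f : ℝ² × ℝ² → ℝ by f(x,y) = c_x²x₁²y₁² + x₁²y₂² + x₂²y₁² + a₂₂x₂²y₂² + 2c_x x₁²y₁y₂ + 2c_y x₁x₂y₁² (i.e., the case a₁₁ = c_x²). Then f is not PSD: there exist x, y ∈ ℝ² with f(x,y) < 0. Concretely, taking y₁ = 1, y₂ = −c_x, x₁ = −c_y, and any x₂ with 0 < x₂ < 2c_y²/(1 + a₂₂c_x²) gives f(x,y) < 0. -/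
/-- In the case `a₁₁ = c_x²` (with `c_x ≥ c_y > 0`, `a₂₂ > 0`), `f` is not
PSD; concretely `f < 0` at `y₁ = 1`, `y₂ = −c_x`, `x₁ = −c_y`, and any
`0 < x₂ < 2c_y²/(1 + a₂₂c_x²)`. -/
theorem not_psd_case_a11_eq_cx_sq (cx cy a22 : ℝ)
    (hxy : cy ≤ cx) (hcy : 0 < cy) (ha22 : 0 < a22) :
    (∀ x2 : ℝ, 0 < x2 → x2 < 2 * cy ^ 2 / (1 + a22 * cx ^ 2) →
      cx ^ 2 * (-cy) ^ 2 * 1 ^ 2 + (-cy) ^ 2 * (-cx) ^ 2 + x2 ^ 2 * 1 ^ 2 +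
        a22 * x2 ^ 2 * (-cx) ^ 2 + 2 * cx * ((-cy) ^ 2 * 1 * (-cx)) +
        2 * cy * ((-cy) * x2 * 1 ^ 2) < 0) ∧
    ∃ x1 x2 y1 y2 : ℝ,
      cx ^ 2 * x1 ^ 2 * y1 ^ 2 + x1 ^ 2 * y2 ^ 2 + x2 ^ 2 * y1 ^ 2 +
        a22 * x2 ^ 2 * y2 ^ 2 + 2 * cx * (x1 ^ 2 * y1 * y2) +
        2 * cy * (x1 * x2 * y1 ^ 2) < 0 := by
  have hD : 0 < 1 + a22 * cx ^ 2 := by positivity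
  have neg_of_lt : ∀ x2 : ℝ, 0 < x2 → x2 < 2 * cy ^ 2 / (1 + a22 * cx ^ 2) →
      cx ^ 2 * (-cy) ^ 2 * 1 ^ 2 + (-cy) ^ 2 * (-cx) ^ 2 + x2 ^ 2 * 1 ^ 2 +
        a22 * x2 ^ 2 * (-cx) ^ 2 + 2 * cx * ((-cy) ^ 2 * 1 * (-cx)) +
        2 * cy * ((-cy) * x2 * 1 ^ 2) < 0 := by
    intro x2 hpos hlt
    rw [lt_div_iff₀ hD] at hlt
    calc
      _ = x2 * (x2 * (1 + a22 * cx ^ 2) - 2 * cy ^ 2) := by ring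
      _ < 0 := mul_neg_of_pos_of_neg hpos (sub_neg.mpr hlt)
  refine ⟨neg_of_lt, -cy, cy ^ 2 / (1 + a22 * cx ^ 2), 1, -cx, neg_of_lt _ (by positivity) ?_⟩
  gcongr
  linarith [pow_pos hcy 2]
end

section
/- Let c_x > c_y > 0 and a₁₁ ∈ ℝ with c_x² < a₁₁ < c_x² + c_y². Define Ω : ℝ → ℝ by Ω(γ) = a₁₁γ²(2−γ)² − 3(1−γ)³c_xc_y + 2(1−γ)²(c_x² + c_y²) + (1−γ)c_xc_y − c_x² − c_y². Then Ω((c_x−c_y)/c_x) > 0 and Ω(1) < 0, and there exists γ₁ with (c_x−c_y)/c_x < γ₁ < 1 such that Ω(γ₁) = 0. -/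
/-- For `c_x > c_y > 0` and `c_x² < a₁₁ < c_x² + c_y²`, the function
`Ω(γ) = a₁₁γ²(2−γ)² − 3(1−γ)³c_xc_y + 2(1−γ)²(c_x² + c_y²) + (1−γ)c_xc_y − c_x² − c_y²`
satisfies `Ω((c_x−c_y)/c_x) > 0`, `Ω(1) < 0`, and has a root strictly between
`(c_x−c_y)/c_x` and `1`. -/
theorem omega_has_root (cx cy a11 : ℝ) (hxy : cy < cx) (hcy : 0 < cy)
    (ha11l : cx ^ 2 < a11) (ha11u : a11 < cx ^ 2 + cy ^ 2)
    (Ω : ℝ → ℝ)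
    (hΩ : ∀ γ : ℝ, Ω γ = a11 * γ ^ 2 * (2 - γ) ^ 2 - 3 * (1 - γ) ^ 3 * cx * cy +
      2 * (1 - γ) ^ 2 * (cx ^ 2 + cy ^ 2) + (1 - γ) * cx * cy - cx ^ 2 - cy ^ 2) :
    0 < Ω ((cx - cy) / cx) ∧ Ω 1 < 0 ∧
    ∃ γ1 : ℝ, (cx - cy) / cx < γ1 ∧ γ1 < 1 ∧ Ω γ1 = 0 := by
  have hcx : 0 < cx := hcy.trans hxy
  have hval : Ω ((cx - cy) / cx) = (a11 - cx ^ 2) * (1 - (cy / cx) ^ 2) ^ 2 := by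
    rw [hΩ]
    field_simp
    ring
  have hratio : (cy / cx) ^ 2 < 1 :=
    pow_lt_one₀ (by positivity) ((div_lt_one hcx).2 hxy) two_ne_zero
  have hleft : 0 < Ω ((cx - cy) / cx) := by
    rw [hval]
    exact mul_pos (sub_pos.2 ha11l) (pow_pos (sub_pos.2 hratio) 2)
  have hright : Ω 1 < 0 := by
    rw [hΩ]
    linarith
  have hlt : (cx - cy) / cx < 1 := (div_lt_one hcx).2 (sub_lt_self cx hcy)
  have hcont : Continuous Ω := by
    rw [funext hΩ]
    fun_prop
  obtain ⟨γ, ⟨hγl, hγu⟩, hγ⟩ :=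
    intermediate_value_Ioo' hlt.le hcont.continuousOn ⟨hright, hleft⟩
  exact ⟨hleft, hright, γ, hγl, hγu, hγ⟩
end

section
/- Let c_x > c_y > 0, let a₁₁, a₂₂ ∈ ℝ, and define f : ℝ² × ℝ² → ℝ by f(x,y) = a₁₁x₁²y₁² + x₁²y₂² + x₂²y₁² + a₂₂x₂²y₂² + 2c_x x₁²y₁y₂ + 2c_y x₁x₂y₁². Define Ω(γ) = a₁₁γ²(2−γ)² − 3(1−γ)³c_xc_y + 2(1−γ)²(c_x² + c_y²) + (1−γ)c_xc_y − c_x² − c_y². Suppose there exists γ₁ with (c_x−c_y)/c_x < γ₁ < 1, Ω(γ₁) = 0, and a₂₂ ≥ γ₃(γ₁) := γ₁²(1−γ₁)(2−γ₁)² / (((γ₁−1)c_x + c_y)(c_x + (γ₁−1)c_y)). Then f is a sum of squares of bilinear forms. -/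
/-- A weighted sum of four squares of bilinear forms with nonnegative weights is a sum of squares
of bilinear forms. -/
lemma IsSOSBilinear22.of_weighted {f : ℝ → ℝ → ℝ → ℝ → ℝ} (w : Fin 4 → ℝ) (hw : ∀ t, 0 ≤ w t)
    (c : Fin 4 → Fin 4 → ℝ)
    (h : ∀ x1 x2 y1 y2 : ℝ, f x1 x2 y1 y2 = ∑ t, w t *
      (c t 0 * (x1 * y1) + c t 1 * (x1 * y2) + c t 2 * (x2 * y1) + c t 3 * (x2 * y2)) ^ 2) :
    IsSOSBilinear22 f := by
  refine ⟨4, fun t i => √(w t) * c t i, fun x1 x2 y1 y2 => ?_⟩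
  rw [h]
  refine Finset.sum_congr rfl fun t _ => ?_
  nth_rewrite 1 [← Real.sq_sqrt (hw t)]
  ring

/-- Case `c_x > c_y > 0`: if `γ₁ ∈ ((c_x−c_y)/c_x, 1)` is a root of `Ω` and
`a₂₂ ≥ γ₃(γ₁)`, then `f` is SOS. -/
theorem sos_case_ii (cx cy a11 a22 : ℝ) (hxy : cy < cx) (hcy : 0 < cy)
    (Ω : ℝ → ℝ)
    (hΩ : ∀ γ : ℝ, Ω γ = a11 * γ ^ 2 * (2 - γ) ^ 2 - 3 * (1 - γ) ^ 3 * cx * cy +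
      2 * (1 - γ) ^ 2 * (cx ^ 2 + cy ^ 2) + (1 - γ) * cx * cy - cx ^ 2 - cy ^ 2)
    (γ1 : ℝ) (hγ1l : (cx - cy) / cx < γ1) (hγ1u : γ1 < 1) (hroot : Ω γ1 = 0)
    (ha22 : γ1 ^ 2 * (1 - γ1) * (2 - γ1) ^ 2 /
      (((γ1 - 1) * cx + cy) * (cx + (γ1 - 1) * cy)) ≤ a22) :
    IsSOSBilinear22 (fun x1 x2 y1 y2 =>
      a11 * x1 ^ 2 * y1 ^ 2 + x1 ^ 2 * y2 ^ 2 + x2 ^ 2 * y1 ^ 2 + a22 * x2 ^ 2 * y2 ^ 2 +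
      2 * cx * (x1 ^ 2 * y1 * y2) + 2 * cy * (x1 * x2 * y1 ^ 2)) := by
  have hcx : 0 < cx := hcy.trans hxy
  obtain ⟨g, rfl⟩ : ∃ g, γ1 = 1 - g := ⟨1 - γ1, by ring⟩
  have hg : 0 < g := by linarith
  have hD : 0 < cy - g * cx := by
    rw [div_lt_iff₀ hcx] at hγ1l
    linarith
  have hg1 : g < 1 := by nlinarith
  have hE : 0 < cx - g * cy := by nlinarith
  have hP : 0 < 1 - g ^ 2 := by nlinarith
  have ha11 : a11 = cx ^ 2 + (cy - g * cx) ^ 2 / (1 - g ^ 2) +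
      g * (cy - g * cx) * (cx - g * cy) / (1 - g ^ 2) ^ 2 := by
    rw [hΩ] at hroot
    field_simp
    linear_combination hroot
  have hγ3 : (1 - g) ^ 2 * (1 - (1 - g)) * (2 - (1 - g)) ^ 2 /
      (((1 - g - 1) * cx + cy) * (cx + (1 - g - 1) * cy)) =
      g * (1 - g ^ 2) ^ 2 / ((cy - g * cx) * (cx - g * cy)) := by
    congr 1 <;> ring
  rw [hγ3] at ha22
  refine IsSOSBilinear22.of_weighted
    ![1, 1 - g ^ 2, g * (cy - g * cx) * (cx - g * cy) / (1 - g ^ 2) ^ 2,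
      a22 - g * (1 - g ^ 2) ^ 2 / ((cy - g * cx) * (cx - g * cy))] ?_
    ![![cx, 1, g, 0], ![(cy - g * cx) / (1 - g ^ 2), 0, 1, 0],
      ![1, 0, 0, -((1 - g ^ 2) ^ 2 / ((cy - g * cx) * (cx - g * cy)))], ![0, 0, 0, 1]] ?_
  · intro t
    fin_cases t
    · exact zero_le_one
    · exact hP.le
    · change 0 ≤ g * (cy - g * cx) * (cx - g * cy) / (1 - g ^ 2) ^ 2
      positivity
    · exact sub_nonneg.2 ha22
  · intro x1 x2 y1 y2
    simp only [Fin.sum_univ_four, Matrix.cons_val]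
    rw [ha11]
    generalize hDdef : cy - g * cx = D at *
    generalize hEdef : cx - g * cy = E at *
    generalize hPdef : 1 - g ^ 2 = P at *
    obtain rfl : cy = D + g * cx := by linarith
    field_simp
    rw [← hPdef]
    ring
end

section
/- Let c_x > c_y > 0, let a₁₁, a₂₂ ∈ ℝ, and define f : ℝ² × ℝ² → ℝ by f(x,y) = a₁₁x₁²y₁² + x₁²y₂² + x₂²y₁² + a₂₂x₂²y₂² + 2c_x x₁²y₁y₂ + 2c_y x₁x₂y₁². Define Ω(γ) = a₁₁γ²(2−γ)² − 3(1−γ)³c_xc_y + 2(1−γ)²(c_x² + c_y²) + (1−γ)c_xc_y − c_x² − c_y². Suppose γ₁ satisfies (c_x−c_y)/c_x < γ₁ < 1 and Ω(γ₁) = 0, and set α = ((γ₁−1)c_x + c_y)/(γ₁(2−γ₁)) and β = (c_x + (γ₁−1)c_y)/(γ₁(2−γ₁)). Then α > 0 and β > 0, and if a₂₂ < γ₃(γ₁) := γ₁²(1−γ₁)(2−γ₁)² / (((γ₁−1)c_x + c_y)(c_x + (γ₁−1)c_y)), then f is not PSD; indeed f(x,y) = a₂₂ − γ₃(γ₁)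 < 0 at the point x₁ = −1/α, x₂ = 1, y₁ = −1/β, y₂ = 1. -/
/-- Case `c_x > c_y > 0`: if `γ₁ ∈ ((c_x−c_y)/c_x, 1)` is a root of `Ω`,
and `α = ((γ₁−1)c_x + c_y)/(γ₁(2−γ₁))`, `β = (c_x + (γ₁−1)c_y)/(γ₁(2−γ₁))`, then `α > 0`,
`β > 0`, and if `a₂₂ < γ₃(γ₁)` then `f` takes the negative value `a₂₂ − γ₃(γ₁)` at
`x₁ = −1/α, x₂ = 1, y₁ = −1/β, y₂ = 1`, so `f` is not PSD. -/
theorem not_psd_case_ii (cx cy a11 a22 : ℝ) (hxy : cy < cx) (hcy : 0 < cy)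
    (Ω : ℝ → ℝ)
    (hΩ : ∀ γ : ℝ, Ω γ = a11 * γ ^ 2 * (2 - γ) ^ 2 - 3 * (1 - γ) ^ 3 * cx * cy +
      2 * (1 - γ) ^ 2 * (cx ^ 2 + cy ^ 2) + (1 - γ) * cx * cy - cx ^ 2 - cy ^ 2)
    (γ1 : ℝ) (hγ1l : (cx - cy) / cx < γ1) (hγ1u : γ1 < 1) (hroot : Ω γ1 = 0)
    (α β : ℝ) (hα : α = ((γ1 - 1) * cx + cy) / (γ1 * (2 - γ1)))
    (hβ : β = (cx + (γ1 - 1) * cy) / (γ1 * (2 - γ1))) :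
    0 < α ∧ 0 < β ∧
    (a22 < γ1 ^ 2 * (1 - γ1) * (2 - γ1) ^ 2 /
        (((γ1 - 1) * cx + cy) * (cx + (γ1 - 1) * cy)) →
      (a11 * (-1 / α) ^ 2 * (-1 / β) ^ 2 + (-1 / α) ^ 2 * 1 ^ 2 + 1 ^ 2 * (-1 / β) ^ 2 +
          a22 * 1 ^ 2 * 1 ^ 2 + 2 * cx * ((-1 / α) ^ 2 * (-1 / β) * 1) +
          2 * cy * ((-1 / α) * 1 * (-1 / β) ^ 2) =
        a22 - γ1 ^ 2 * (1 - γ1) * (2 - γ1) ^ 2 /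
          (((γ1 - 1) * cx + cy) * (cx + (γ1 - 1) * cy))) ∧
      a11 * (-1 / α) ^ 2 * (-1 / β) ^ 2 + (-1 / α) ^ 2 * 1 ^ 2 + 1 ^ 2 * (-1 / β) ^ 2 +
          a22 * 1 ^ 2 * 1 ^ 2 + 2 * cx * ((-1 / α) ^ 2 * (-1 / β) * 1) +
          2 * cy * ((-1 / α) * 1 * (-1 / β) ^ 2) < 0) := by
  have hcx : 0 < cx := hcy.trans hxy
  have hp : 0 < (γ1 - 1) * cx + cy := by
    rw [div_lt_iff₀ hcx] at hγ1l
    linarith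
  have hγ : 0 < γ1 := (div_pos (sub_pos.2 hxy) hcx).trans hγ1l
  have hq : 0 < cx + (γ1 - 1) * cy := by nlinarith
  have hD : 0 < γ1 * (2 - γ1) := mul_pos hγ (by linarith)
  have hα0 : 0 < α := hα ▸ div_pos hp hD
  have hβ0 : 0 < β := hβ ▸ div_pos hq hD
  have hpα : (γ1 - 1) * cx + cy = α * (γ1 * (2 - γ1)) := by
    rw [hα, div_mul_cancel₀ _ hD.ne']
  have hqβ : cx + (γ1 - 1) * cy = β * (γ1 * (2 - γ1)) := by
    rw [hβ, div_mul_cancel₀ _ hD.ne']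
  have key : a11 + α ^ 2 + β ^ 2 - 2 * cx * β - 2 * cy * α + (1 - γ1) * α * β = 0 := by
    rw [hΩ] at hroot
    rw [hα, hβ]
    have h2 : 2 - γ1 ≠ 0 := by linarith
    field_simp
    linear_combination hroot
  have hγ₃ : γ1 ^ 2 * (1 - γ1) * (2 - γ1) ^ 2 /
      (((γ1 - 1) * cx + cy) * (cx + (γ1 - 1) * cy)) = (1 - γ1) / (α * β) := by
    have h2 : 2 - γ1 ≠ 0 := by linarith
    rw [hpα, hqβ]
    field_simp
  refine ⟨hα0, hβ0, fun ha => ?_⟩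
  rw [hγ₃] at ha ⊢
  have hval : a11 * (-1 / α) ^ 2 * (-1 / β) ^ 2 + (-1 / α) ^ 2 * 1 ^ 2 + 1 ^ 2 * (-1 / β) ^ 2 +
      a22 * 1 ^ 2 * 1 ^ 2 + 2 * cx * ((-1 / α) ^ 2 * (-1 / β) * 1) +
      2 * cy * ((-1 / α) * 1 * (-1 / β) ^ 2) = a22 - (1 - γ1) / (α * β) := by
    clear hα hβ
    field_simp
    linear_combination key
  exact ⟨hval, hval ▸ sub_neg.2 ha⟩
end
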